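/- arXiv:2406.03709 — 2 statements merged into one kernel-verified Lean document; each statement's English description precedes it below -/
import Mathlib

section
/- There exists a positive solution (P₊, P₋) of the Riccati system, and any such solution satisfies exp(−∫_t^T μ_sᵀ Σ_s⁻¹ μ_s ds) ≤ P_{±,t} ≤ 1 for all t ∈ [0,T] (note each Σ_s is invertible by the ellipticity assumption). -/
open MeasureTheory Set

/-- The Hamiltonian `H₊(t, v, P₊, P₋)` of the constrained LQ problem. -/
noncomputable def Hplus {E : Type} [MeasurableSpace E] {m n ℓ : ℕ}
    (μ : ℝ → Fin m → ℝ) (σ : ℝ → Matrix (Fin m) (Fin n) ℝ)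
    (ν : Fin ℓ → Measure E) (β : Fin ℓ → ℝ → E → Fin m → ℝ)
    (t : ℝ) (v : Fin m → ℝ) (Pp Pm : ℝ) : ℝ :=
  Pp * ∑ k, (∑ i, σ t i k * v i) ^ 2 + 2 * Pp * ∑ i, μ t i * v i
    + ∑ j, ∫ e, (Pp * ((max (1 + ∑ i, v i * β j t e i) 0) ^ 2
          - 1 - 2 * ∑ i, v i * β j t e i)
        + Pm * (max (-(1 + ∑ i, v i * β j t e i)) 0) ^ 2) ∂(ν j)

/-- The Hamiltonian `H₋(t, v, P₊, P₋)` of the constrained LQ problem. -/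
noncomputable def Hminus {E : Type} [MeasurableSpace E] {m n ℓ : ℕ}
    (μ : ℝ → Fin m → ℝ) (σ : ℝ → Matrix (Fin m) (Fin n) ℝ)
    (ν : Fin ℓ → Measure E) (β : Fin ℓ → ℝ → E → Fin m → ℝ)
    (t : ℝ) (v : Fin m → ℝ) (Pp Pm : ℝ) : ℝ :=
  Pm * ∑ k, (∑ i, σ t i k * v i) ^ 2 - 2 * Pm * ∑ i, μ t i * v i
    + ∑ j, ∫ e, (Pm * ((max (1 - ∑ i, v i * β j t e i) 0) ^ 2
          - 1 + 2 * ∑ i, v i * β j t e i)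
        + Pp * (max (-(1 - ∑ i, v i * β j t e i)) 0) ^ 2) ∂(ν j)

/-- `H*₊(t, P₊, P₋) = inf_{v ∈ ℝ^m₊} H₊(t, v, P₊, P₋)`. -/
noncomputable def HstarPlus {E : Type} [MeasurableSpace E] {m n ℓ : ℕ}
    (μ : ℝ → Fin m → ℝ) (σ : ℝ → Matrix (Fin m) (Fin n) ℝ)
    (ν : Fin ℓ → Measure E) (β : Fin ℓ → ℝ → E → Fin m → ℝ)
    (t : ℝ) (Pp Pm : ℝ) : ℝ :=
  sInf ((fun v => Hplus μ σ ν β t v Pp Pm) '' {v : Fin m → ℝ | ∀ i, 0 ≤ v i})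

/-- `H*₋(t, P₊, P₋) = inf_{v ∈ ℝ^m₊} H₋(t, v, P₊, P₋)`. -/
noncomputable def HstarMinus {E : Type} [MeasurableSpace E] {m n ℓ : ℕ}
    (μ : ℝ → Fin m → ℝ) (σ : ℝ → Matrix (Fin m) (Fin n) ℝ)
    (ν : Fin ℓ → Measure E) (β : Fin ℓ → ℝ → E → Fin m → ℝ)
    (t : ℝ) (Pp Pm : ℝ) : ℝ :=
  sInf ((fun v => Hminus μ σ ν β t v Pp Pm) '' {v : Fin m → ℝ | ∀ i, 0 ≤ v i})

/-- `Σ_t = σ_t σ_tᵀ + ∑_j ∫_E β_{j,t}(e) β_{j,t}(e)ᵀ ν_j(de)`, defined entrywise. -/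
noncomputable def SigmaMat {E : Type} [MeasurableSpace E] {m n ℓ : ℕ}
    (σ : ℝ → Matrix (Fin m) (Fin n) ℝ) (ν : Fin ℓ → Measure E)
    (β : Fin ℓ → ℝ → E → Fin m → ℝ) (t : ℝ) : Matrix (Fin m) (Fin m) ℝ :=
  Matrix.of fun i k => (∑ j', σ t i j' * σ t k j') + ∑ j, ∫ e, β j t e i * β j t e k ∂(ν j)

/-- A pair of continuous positive functions `(P₊, P₋)` on `[0,T]` solving the Riccati
system `P_{±,t} = 1 + ∫_t^T H*_±(s, P_{+,s}, P_{−,s}) ds`. -/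
def IsPositiveRiccatiSolution {E : Type} [MeasurableSpace E] {m n ℓ : ℕ}
    (μ : ℝ → Fin m → ℝ) (σ : ℝ → Matrix (Fin m) (Fin n) ℝ)
    (ν : Fin ℓ → Measure E) (β : Fin ℓ → ℝ → E → Fin m → ℝ)
    (T : ℝ) (Pp Pm : ℝ → ℝ) : Prop :=
  ContinuousOn Pp (Icc 0 T) ∧ ContinuousOn Pm (Icc 0 T) ∧
  (∀ t ∈ Icc (0:ℝ) T, 0 < Pp t ∧ 0 < Pm t) ∧
  (∀ t ∈ Icc (0:ℝ) T, Pp t = 1 + ∫ s in t..T, HstarPlus μ σ ν β s (Pp s) (Pm s)) ∧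
  (∀ t ∈ Icc (0:ℝ) T, Pm t = 1 + ∫ s in t..T, HstarMinus μ σ ν β s (Pp s) (Pm s))

/-- `Q`, `q`, `l` are the quadratic, excess and linear parts of a Hamiltonian
`x * (Q - q + l) + y * q` over the control set `S`, and `θ` dominates `l` relative to `Q`. -/
structure IsHamiltonianData {V : Type*} (S : Set V) (Q q l : V → ℝ) (θ : ℝ) : Prop where
  exists_zero : ∃ v ∈ S, Q v = 0 ∧ q v = 0 ∧ l v = 0
  nonneg : ∀ v, 0 ≤ q v
  le_quad : ∀ v, q v ≤ Q v
  complete_sq : ∀ v r, 0 ≤ Q v + r * l v + r ^ 2 * θ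

namespace IsHamiltonianData

variable {V : Type*} {S : Set V} {Q q l : V → ℝ} {θ : ℝ}

theorem theta_nonneg (h : IsHamiltonianData S Q q l θ) : 0 ≤ θ := by
  obtain ⟨v, -, h1, -, h3⟩ := h.exists_zero
  have := h.complete_sq v 1
  simpa [h1, h3] using this

theorem le_apply (h : IsHamiltonianData S Q q l θ) {x y : ℝ} (hx : 0 < x) (hy : 0 < y) (v : V) :
    -(x ^ 2 * θ / min x y) ≤ x * (Q v - q v + l v) + y * q v := by
  have hp : 0 < min x y := lt_min hx hy
  have h1 : min x y * (Q v - q v) ≤ x * (Q v - q v) :=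
    mul_le_mul_of_nonneg_right (min_le_left _ _) (sub_nonneg.2 (h.le_quad v))
  have h2 : min x y * q v ≤ y * q v :=
    mul_le_mul_of_nonneg_right (min_le_right _ _) (h.nonneg v)
  have h3 := mul_nonneg hp.le (h.complete_sq v (x / min x y))
  have h4 : min x y * (Q v + x / min x y * l v + (x / min x y) ^ 2 * θ)
      = min x y * Q v + x * l v + x ^ 2 * θ / min x y := by
    field_simp
  rw [h4] at h3
  nlinarith

theorem bddBelow (h : IsHamiltonianData S Q q l θ) {x y : ℝ} (hx : 0 < x) (hy : 0 < y) :
    BddBelow ((fun v => x * (Q v - q v + l v) + y * q v) '' S) :=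
  ⟨_, by rintro _ ⟨v, -, rfl⟩; exact h.le_apply hx hy v⟩

theorem nonempty (h : IsHamiltonianData S Q q l θ) (f : V → ℝ) : (f '' S).Nonempty := by
  obtain ⟨v, hv, -⟩ := h.exists_zero
  exact ⟨_, v, hv, rfl⟩

theorem sInf_nonpos (h : IsHamiltonianData S Q q l θ) {x y : ℝ} (hx : 0 < x) (hy : 0 < y) :
    sInf ((fun v => x * (Q v - q v + l v) + y * q v) '' S) ≤ 0 := by
  obtain ⟨v, hv, h1, h2, h3⟩ := h.exists_zero
  exact csInf_le (h.bddBelow hx hy) ⟨v, hv, by simp [h1, h2, h3]⟩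

theorem le_sInf (h : IsHamiltonianData S Q q l θ) {x y : ℝ} (hx : 0 < x) (hy : 0 < y) :
    -(x ^ 2 * θ / min x y) ≤ sInf ((fun v => x * (Q v - q v + l v) + y * q v) '' S) :=
  le_csInf (h.nonempty _) (by rintro _ ⟨v, -, rfl⟩; exact h.le_apply hx hy v)

theorem sInf_le_sInf_add (h : IsHamiltonianData S Q q l θ) {c Θ x y x' y' : ℝ} (hc : 0 < c)
    (hΘ : θ ≤ Θ) (hx : x ∈ Icc c 1) (hy : y ∈ Icc c 1) (hx' : x' ∈ Icc c 1) (hy' : y' ∈ Icc c 1) :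
    sInf ((fun v => x' * (Q v - q v + l v) + y' * q v) '' S) ≤
      sInf ((fun v => x * (Q v - q v + l v) + y * q v) '' S) +
        (4 * Θ / c ^ 2 + 4 * Θ / c) * (|x' - x| + |y' - y|) := by
  have hΘ0 : 0 ≤ Θ := h.theta_nonneg.trans hΘ
  rw [← sub_le_iff_le_add]
  refine le_csInf (h.nonempty _) ?_
  rintro _ ⟨v, hv, rfl⟩
  have hx'0 := hc.trans_le hx'.1
  have hy'0 := hc.trans_le hy'.1
  rw [sub_le_iff_le_add]
  have hK : 0 ≤ (4 * Θ / c ^ 2 + 4 * Θ / c) * (|x' - x| + |y' - y|) := by positivity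
  rcases le_or_gt (x * (Q v - q v + l v) + y * q v) 0 with hle | hgt
  swap
  · have := h.sInf_nonpos hx'0 hy'0
    simp only at hgt ⊢
    linarith
  have hq := h.nonneg v
  have hqQ := h.le_quad v
  have hl : |l v| ≤ c / 2 * Q v + 2 / c * Θ := by
    have e1 := mul_nonneg (half_pos hc).le (h.complete_sq v (2 / c))
    have e2 := mul_nonneg (half_pos hc).le (h.complete_sq v (-(2 / c)))
    have f1 : c / 2 * (Q v + 2 / c * l v + (2 / c) ^ 2 * θ) = c / 2 * Q v + l v + 2 / c * θ := by
      field_simp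
    have f2 : c / 2 * (Q v + -(2 / c) * l v + (-(2 / c)) ^ 2 * θ)
        = c / 2 * Q v - l v + 2 / c * θ := by
      field_simp
      ring
    rw [f1] at e1
    rw [f2] at e2
    have : 2 / c * θ ≤ 2 / c * Θ := by gcongr
    rw [abs_le]
    constructor <;> linarith
  have hcQ : c * Q v ≤ |l v| := by
    have e1 : c * (Q v - q v) ≤ x * (Q v - q v) :=
      mul_le_mul_of_nonneg_right hx.1 (sub_nonneg.2 hqQ)
    have e2 : c * q v ≤ y * q v := mul_le_mul_of_nonneg_right hy.1 hq
    have e3 : -(x * l v) ≤ |l v| := by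
      have : |x * l v| ≤ |l v| := by
        rw [abs_mul, abs_of_pos (hc.trans_le hx.1)]
        exact mul_le_of_le_one_left (abs_nonneg _) hx.2
      exact (neg_le_abs _).trans this
    nlinarith
  have hQ : Q v ≤ 4 * Θ / c ^ 2 := by
    rw [le_div_iff₀ (by positivity)]
    have : c / 2 * Q v ≤ 2 / c * Θ := by linarith
    have := mul_le_mul_of_nonneg_left this (by positivity : 0 ≤ 2 * c)
    have e : 2 * c * (2 / c * Θ) = 4 * Θ := by field_simp; ring
    nlinarith
  have hl' : |l v| ≤ 4 * Θ / c := by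
    have e : c / 2 * (4 * Θ / c ^ 2) + 2 / c * Θ = 4 * Θ / c := by field_simp; ring
    have := mul_le_mul_of_nonneg_left hQ (half_pos hc).le
    linarith
  have hd1 : (x' - x) * (Q v - q v + l v) ≤ |x' - x| * (4 * Θ / c ^ 2 + 4 * Θ / c) := by
    refine (le_abs_self _).trans ?_
    rw [abs_mul]
    refine mul_le_mul_of_nonneg_left ?_ (abs_nonneg _)
    refine (abs_add_le _ _).trans (add_le_add ?_ hl')
    rw [abs_of_nonneg (sub_nonneg.2 hqQ)]
    linarith
  have hd2 : (y' - y) * q v ≤ |y' - y| * (4 * Θ / c ^ 2 + 4 * Θ / c) := by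
    refine (le_abs_self _).trans ?_
    rw [abs_mul, abs_of_nonneg hq]
    refine mul_le_mul_of_nonneg_left ?_ (abs_nonneg _)
    have : 0 ≤ 4 * Θ / c := by positivity
    linarith
  have := csInf_le (h.bddBelow hx'0 hy'0) ⟨v, hv, rfl⟩
  simp only at this ⊢
  nlinarith

theorem abs_sInf_sub_le (h : IsHamiltonianData S Q q l θ) {c Θ x y x' y' : ℝ} (hc : 0 < c)
    (hΘ : θ ≤ Θ) (hx : x ∈ Icc c 1) (hy : y ∈ Icc c 1) (hx' : x' ∈ Icc c 1) (hy' : y' ∈ Icc c 1) :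
    |sInf ((fun v => x * (Q v - q v + l v) + y * q v) '' S) -
      sInf ((fun v => x' * (Q v - q v + l v) + y' * q v) '' S)| ≤
        (4 * Θ / c ^ 2 + 4 * Θ / c) * (|x - x'| + |y - y'|) := by
  have h1 := h.sInf_le_sInf_add hc hΘ hx hy hx' hy'
  have h2 := h.sInf_le_sInf_add hc hΘ hx' hy' hx hy
  rw [abs_sub_comm x' x, abs_sub_comm y' y] at h1
  rw [abs_le]
  constructor <;> linarith

end IsHamiltonianData

theorem IntervalIntegrable.to_right_of_mem {X : Type*} [NormedAddCommGroup X] {f : ℝ → X}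
    {T t : ℝ} (h : IntervalIntegrable f volume 0 T) (ht : t ∈ Icc 0 T) :
    IntervalIntegrable f volume t T :=
  h.mono_set <| by
    rw [uIcc_of_le ht.2, uIcc_of_le (ht.1.trans ht.2)]
    exact Icc_subset_Icc_left ht.1

theorem IntervalIntegrable.continuousOn_integral_to_right {X : Type*} [NormedAddCommGroup X]
    [NormedSpace ℝ X] {f : ℝ → X} {T : ℝ} (h : IntervalIntegrable f volume 0 T) (hT : 0 ≤ T) :
    ContinuousOn (fun t => ∫ s in t..T, f s) (Icc 0 T) := by
  have h1 := (intervalIntegral.continuousOn_primitive_interval' h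
    (right_mem_uIcc : T ∈ uIcc 0 T)).neg
  rw [uIcc_of_le hT] at h1
  exact h1.congr fun t _ => intervalIntegral.integral_symm _ _

/-- Carathéodory form of the Picard–Lindelöf theorem, backward in time from `T`. -/
theorem exists_caratheodory_solution {X : Type*} [NormedAddCommGroup X] [NormedSpace ℝ X]
    [CompleteSpace X] {T K : ℝ} (hT : 0 ≤ T) (hK : 0 ≤ K) {F : ℝ → X → X}
    (hint : ∀ f : ℝ → X, Continuous f → IntervalIntegrable (fun s => F s (f s)) volume 0 T)
    (hLip : ∀ s ∈ Icc 0 T, ∀ x y, ‖F s x - F s y‖ ≤ K * ‖x - y‖) (x₀ : X) :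
    ∃ f : ℝ → X, Continuous f ∧ ∀ t ∈ Icc 0 T, f t = x₀ + ∫ s in t..T, F s (f s) := by
  let ext : C(Icc 0 T, X) → ℝ → X := fun g => IccExtend hT g
  have hext : ∀ g, Continuous (ext g) := fun g => g.continuous.Icc_extend'
  have hcont : ∀ g, ContinuousOn (fun t => x₀ + ∫ s in t..T, F s (ext g s)) (Icc 0 T) := by
    intro g
    have h := hint _ (hext g)
    exact continuousOn_const.add (h.continuousOn_integral_to_right hT)
  let Φ : C(Icc 0 T, X) → C(Icc 0 T, X) := fun g =>
    ⟨(Icc 0 T).domRestrict fun t => x₀ + ∫ s in t..T, F s (ext g s), (hcont g).domRestrict⟩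
  have hiter : ∀ (k : ℕ) (g g' : C(Icc 0 T, X)) (t : Icc 0 T),
      ‖Φ^[k] g t - Φ^[k] g' t‖ ≤ (K * (T - t)) ^ k / k.factorial * dist g g' := by
    intro k g g'
    induction k with
    | zero =>
      intro t
      simpa [dist_eq_norm] using ContinuousMap.dist_apply_le_dist (f := g) (g := g') t
    | succ k ih =>
      intro t
      rw [Function.iterate_succ_apply', Function.iterate_succ_apply']
      set u := Φ^[k] g
      set w := Φ^[k] g'
      have hu := (hint _ (hext u)).to_right_of_mem t.2
      have hw := (hint _ (hext w)).to_right_of_mem t.2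
      have e : Φ u t - Φ w t = ∫ s in t..T, (F s (ext u s) - F s (ext w s)) := by
        rw [intervalIntegral.integral_sub hu hw]
        exact add_sub_add_left_eq_sub _ _ _
      rw [e]
      have hb : ∀ s ∈ Icc (t : ℝ) T, ‖F s (ext u s) - F s (ext w s)‖ ≤
          K ^ (k + 1) / k.factorial * dist g g' * (T - s) ^ k := by
        intro s hs
        have hs' : s ∈ Icc 0 T := ⟨t.2.1.trans hs.1, hs.2⟩
        have h1 := hLip s hs' (ext u s) (ext w s)
        have h2 := ih ⟨s, hs'⟩
        simp only [ext, IccExtend_of_mem hT _ hs'] at h1 ⊢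
        refine h1.trans ((mul_le_mul_of_nonneg_left h2 hK).trans_eq ?_)
        rw [mul_pow]
        ring
      refine (intervalIntegral.norm_integral_le_of_norm_le t.2.2
        (Filter.Eventually.of_forall fun s hs => hb s ⟨hs.1.le, hs.2⟩)
        (Continuous.intervalIntegrable (by fun_prop) _ _)).trans_eq ?_
      rw [intervalIntegral.integral_const_mul,
        intervalIntegral.integral_comp_sub_left (fun x => x ^ k) T, integral_pow]
      rw [Nat.factorial_succ]
      push_cast
      have := Nat.factorial_ne_zero k
      rw [mul_pow K, pow_succ (T - (t : ℝ))]
      field_simp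
      simp [mul_assoc]
  obtain ⟨k, hk⟩ : ∃ k : ℕ, (K * T) ^ k / k.factorial < 1 :=
    ((FloorSemiring.tendsto_pow_div_factorial_atTop (K * T)).eventually_lt_const one_pos).exists
  have hKT : 0 ≤ K * T := mul_nonneg hK hT
  have hq : 0 ≤ (K * T) ^ k / k.factorial := by positivity
  have hcontr : ContractingWith ⟨(K * T) ^ k / k.factorial, hq⟩ Φ^[k] := by
    refine ⟨by exact_mod_cast hk, LipschitzWith.of_dist_le_mul fun g g' => ?_⟩
    refine (ContinuousMap.dist_le (mul_nonneg hq dist_nonneg)).2 fun t => ?_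
    rw [dist_eq_norm]
    refine (hiter k g g' t).trans ?_
    change _ ≤ (K * T) ^ k / k.factorial * dist g g'
    have := t.2.1
    have h0 : 0 ≤ T - t := sub_nonneg.2 t.2.2
    gcongr
    linarith
  have hne : Nonempty C(Icc 0 T, X) := ⟨0⟩
  have hfix := hcontr.isFixedPt_fixedPoint_iterate
  set g := hcontr.fixedPoint Φ^[k]
  refine ⟨ext g, hext g, fun t ht => ?_⟩
  have : Φ g ⟨t, ht⟩ = g ⟨t, ht⟩ := by rw [hfix]
  simp only [ext, IccExtend_of_mem hT _ ht]
  rw [← this]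
  rfl

theorem le_integral_of_le_on_pos {T : ℝ} {d k b : ℝ → ℝ} (hd : ContinuousOn d (Icc 0 T))
    (hk : IntervalIntegrable k volume 0 T) (hb : IntervalIntegrable b volume 0 T)
    (hb0 : ∀ s ∈ Icc 0 T, 0 ≤ b s) (hdk : ∀ t ∈ Icc 0 T, d t = ∫ s in t..T, k s)
    (hkb : ∀ s ∈ Icc 0 T, 0 < d s → k s ≤ b s) {t : ℝ} (ht : t ∈ Icc 0 T) :
    d t ≤ ∫ s in t..T, b s := by
  have hnn : 0 ≤ ∫ s in t..T, b s :=
    intervalIntegral.integral_nonneg ht.2 fun s hs => hb0 s ⟨ht.1.trans hs.1, hs.2⟩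
  rcases le_or_gt (d t) 0 with h | h
  · exact h.trans hnn
  have hsub : Icc t T ⊆ Icc 0 T := Icc_subset_Icc_left ht.1
  have hT : T ∈ Icc 0 T := ⟨ht.1.trans ht.2, le_rfl⟩
  have hdT : d T = 0 := by rw [hdk T hT, intervalIntegral.integral_same]
  have hcl : IsCompact (Icc t T ∩ d ⁻¹' Iic 0) :=
    isCompact_Icc.of_isClosed_subset
      ((hd.mono hsub).preimage_isClosed_of_isClosed isClosed_Icc isClosed_Iic) inter_subset_left
  obtain ⟨τ, ⟨hτ, hτd⟩, hmin⟩ := hcl.exists_isLeast ⟨T, ⟨ht.2, le_rfl⟩, hdT.le⟩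
  have hpos : ∀ s ∈ Ico t τ, 0 < d s := fun s hs => by
    by_contra! hle
    exact (hmin ⟨⟨hs.1, hs.2.le.trans hτ.2⟩, hle⟩).not_gt hs.2
  have hτ0 := hsub hτ
  have hkt := hk.to_right_of_mem ht
  have hkτ := hk.to_right_of_mem hτ0
  have hbt := hb.to_right_of_mem ht
  have hbτ := hb.to_right_of_mem hτ0
  have e1 : (∫ s in t..τ, k s) + ∫ s in τ..T, k s = ∫ s in t..T, k s :=
    intervalIntegral.integral_add_adjacent_intervals (hkt.trans hkτ.symm) hkτ
  have e2 : (∫ s in t..τ, b s) + ∫ s in τ..T, b s = ∫ s in t..T, b s :=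
    intervalIntegral.integral_add_adjacent_intervals (hbt.trans hbτ.symm) hbτ
  have h1 : ∫ s in t..τ, k s ≤ ∫ s in t..τ, b s :=
    intervalIntegral.integral_mono_on_of_le_Ioo hτ.1 (hkt.trans hkτ.symm) (hbt.trans hbτ.symm)
      fun s hs => hkb s ⟨ht.1.trans hs.1.le, hs.2.le.trans hτ.2⟩ (hpos s ⟨hs.1.le, hs.2⟩)
  have h2 : 0 ≤ ∫ s in τ..T, b s :=
    intervalIntegral.integral_nonneg hτ.2 fun s hs => hb0 s ⟨hτ0.1.trans hs.1, hs.2⟩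
  have h3 : d τ ≤ 0 := hτd
  rw [hdk τ hτ0] at h3
  rw [hdk t ht]
  linarith

/-- Backward Grönwall inequality with zero terminal value. -/
theorem nonpos_of_le_mul_integral {T K : ℝ} {f : ℝ → ℝ} (hf : ContinuousOn f (Icc 0 T))
    (hK : 0 ≤ K) (h : ∀ t ∈ Icc 0 T, f t ≤ K * ∫ s in t..T, f s) {t : ℝ} (ht : t ∈ Icc 0 T) :
    f t ≤ 0 := by
  have hT : 0 ≤ T := ht.1.trans ht.2
  set g : ℝ → ℝ := IccExtend hT ((Icc 0 T).domRestrict f) with hg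
  have hgc : Continuous g := hf.domRestrict.Icc_extend'
  have hgf : ∀ s ∈ Icc 0 T, g s = f s := fun s hs => by simp [hg, IccExtend_of_mem hT _ hs]
  have hint : ∀ s ∈ Icc 0 T, ∫ r in s..T, g r = ∫ r in s..T, f r := fun s hs =>
    intervalIntegral.integral_congr fun r hr => by
      rw [uIcc_of_le hs.2] at hr
      exact hgf r ⟨hs.1.trans hr.1, hr.2⟩
  have hder : ∀ s, HasDerivAt (fun r => (∫ x in r..T, g x) * Real.exp (K * r))
      (-g s * Real.exp (K * s) + (∫ x in s..T, g x) * (Real.exp (K * s) * K)) s := fun s =>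
    (intervalIntegral.integral_hasDerivAt_left (hgc.intervalIntegrable _ _)
      (hgc.stronglyMeasurableAtFilter _ _) hgc.continuousAt).mul
      (by simpa using ((hasDerivAt_id s).const_mul K).exp)
  have hmono : MonotoneOn (fun r => (∫ x in r..T, g x) * Real.exp (K * r)) (Icc 0 T) := by
    refine monotoneOn_of_deriv_nonneg (convex_Icc 0 T)
      (fun s _ => (hder s).continuousAt.continuousWithinAt)
      (fun s _ => (hder s).differentiableAt.differentiableWithinAt) fun s hs => ?_
    rw [interior_Icc] at hs
    have hs' := Ioo_subset_Icc_self hs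
    rw [(hder s).deriv]
    have h1 := h s hs'
    rw [← hint s hs', ← hgf s hs'] at h1
    nlinarith [Real.exp_pos (K * s)]
  have h2 := hmono ht ⟨hT, le_rfl⟩ ht.2
  simp only [intervalIntegral.integral_same, zero_mul] at h2
  have h3 : ∫ x in t..T, g x ≤ 0 := by
    by_contra! hc
    exact h2.not_gt (mul_pos hc (Real.exp_pos _))
  rw [hint t ht] at h3
  exact (h t ht).trans (mul_nonpos_of_nonneg_of_nonpos hK h3)

theorem exp_neg_integral_eq {T Θ : ℝ} {θ : ℝ → ℝ} (hθ : IntervalIntegrable θ volume 0 T)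
    (hb : ∀ s ∈ Icc 0 T, 0 ≤ θ s ∧ θ s ≤ Θ) {t : ℝ} (ht : t ∈ Icc 0 T) :
    Real.exp (-∫ s in t..T, θ s) =
      1 + ∫ s in t..T, -(θ s * Real.exp (-∫ r in s..T, θ r)) := by
  have hT : 0 ≤ T := ht.1.trans ht.2
  have hθt := hθ.to_right_of_mem ht
  set I : ℝ → ℝ := fun s => ∫ r in s..T, θ r with hI
  have hlip : AbsolutelyContinuousOnInterval (fun s => Real.exp (-I s)) t T := by
    have hΘ : 0 ≤ Θ := (hb t ht).1.trans (hb t ht).2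
    have key : ∀ s ∈ Icc t T, ∀ r ∈ Icc t T, s ≤ r →
        dist (Real.exp (-I s)) (Real.exp (-I r)) ≤ Θ * dist s r := by
      intro s hs r hr hsr
      have hs0 : s ∈ Icc 0 T := ⟨ht.1.trans hs.1, hs.2⟩
      have hr0 : r ∈ Icc 0 T := ⟨ht.1.trans hr.1, hr.2⟩
      have hir := hθ.to_right_of_mem hr0
      have hisr := (hθ.to_right_of_mem hs0).trans hir.symm
      have e : (∫ x in s..r, θ x) + I r = I s :=
        intervalIntegral.integral_add_adjacent_intervals hisr hir
      have hmem : ∀ x ∈ Icc s r, x ∈ Icc 0 T := fun x hx =>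
        ⟨hs0.1.trans hx.1, hx.2.trans hr.2⟩
      have hJ0 : 0 ≤ ∫ x in s..r, θ x :=
        intervalIntegral.integral_nonneg hsr fun x hx => (hb x (hmem x hx)).1
      have hJ1 : ∫ x in s..r, θ x ≤ Θ * (r - s) := by
        have := intervalIntegral.integral_mono_on hsr hisr
          (intervalIntegrable_const (c := Θ)) fun x hx => (hb x (hmem x hx)).2
        simpa [mul_comm] using this
      have hIr : 0 ≤ I r :=
        intervalIntegral.integral_nonneg hr.2 fun x hx => (hb x ⟨hr0.1.trans hx.1, hx.2⟩).1
      have h1 : Real.exp (-I s) = Real.exp (-∫ x in s..r, θ x) * Real.exp (-I r) := by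
        rw [← Real.exp_add, ← e]
        ring_nf
      have h2 : Real.exp (-I r) ≤ 1 := Real.exp_le_one_iff.2 (neg_nonpos.2 hIr)
      have h3 := Real.add_one_le_exp (-∫ x in s..r, θ x)
      have h4 : Real.exp (-∫ x in s..r, θ x) ≤ 1 := Real.exp_le_one_iff.2 (neg_nonpos.2 hJ0)
      have h5 := Real.exp_pos (-I r)
      rw [dist_comm s r, Real.dist_eq, Real.dist_eq, abs_of_nonneg (sub_nonneg.2 hsr), h1, abs_le]
      constructor <;> nlinarith
    refine LipschitzOnWith.absolutelyContinuousOnInterval (K := ⟨Θ, hΘ⟩) ?_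
    refine LipschitzOnWith.of_dist_le_mul fun s hs r hr => ?_
    rw [uIcc_of_le ht.2] at hs hr
    rcases le_total s r with h | h
    · exact key s hs r hr h
    · rw [dist_comm, dist_comm s r]
      exact key r hr s hs h
  have h1 := hlip.integral_deriv_eq_sub
  have h2 : ∫ s in t..T, deriv (fun s => Real.exp (-I s)) s =
      ∫ s in t..T, θ s * Real.exp (-I s) := by
    refine intervalIntegral.integral_congr_ae ?_
    filter_upwards [hθt.ae_hasDerivAt_integral] with s hs hst
    have h3 := (hs (uIoc_subset_uIcc hst) T right_mem_uIcc)
    have h4 : HasDerivAt I (-θ s) s := by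
      have : I = fun x => -∫ r in T..x, θ r := by
        funext x; exact intervalIntegral.integral_symm _ _
      rw [this]
      exact h3.neg
    rw [h4.fun_neg.exp.deriv]
    ring
  rw [intervalIntegral.integral_neg, ← h2, h1]
  simp [hI]

/-- Truncation of a real number to the interval `[c, 1]`. -/
noncomputable def clip (c x : ℝ) : ℝ := max c (min x 1)

theorem clip_mem {c : ℝ} (hc : c ≤ 1) (x : ℝ) : clip c x ∈ Icc c 1 :=
  ⟨le_max_left _ _, max_le hc (min_le_right _ _)⟩

theorem clip_of_mem {c x : ℝ} (hx : x ∈ Icc c 1) : clip c x = x := by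
  rw [clip, min_eq_left hx.2, max_eq_right hx.1]

@[fun_prop]
theorem continuous_clip (c : ℝ) : Continuous (clip c) := by
  unfold clip
  fun_prop

theorem abs_clip_sub_clip_le (c x y : ℝ) : |clip c x - clip c y| ≤ |x - y| := by
  unfold clip
  rw [max_comm c, max_comm c]
  refine (abs_max_sub_max_le_abs _ _ _).trans ((abs_min_sub_min_le_max _ _ _ _).trans ?_)
  simp

theorem neg_theta_sub_le {c L P R θ Θ : ℝ} (hc : 0 < c) (hL : L ∈ Icc c 1) (hPL : P < L)
    (hθ : 0 ≤ θ) (hθΘ : θ ≤ Θ) :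
    clip c P ^ 2 * θ / min (clip c P) (clip c R) - θ * L ≤
      Θ / c * max (L - P) (max (L - R) 0) := by
  have hc1 : c ≤ 1 := hL.1.trans hL.2
  have hx := clip_mem hc1 P
  have hy := clip_mem hc1 R
  have hxL : clip c P ≤ L := max_le hL.1 ((min_le_left _ _).trans hPL.le)
  set x := clip c P
  have hx0 : 0 < x := hc.trans_le hx.1
  have hm : 0 ≤ max (L - P) (max (L - R) 0) := le_max_of_le_right (le_max_right _ _)
  have hΘ : 0 ≤ Θ := hθ.trans hθΘ
  have hL0 : 0 < L := hc.trans_le hL.1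
  rcases le_or_gt x (clip c R) with h | h
  · rw [min_eq_left h]
    have e : x ^ 2 * θ / x = θ * x := by field_simp
    rw [e]
    have : 0 ≤ Θ / c * max (L - P) (max (L - R) 0) := by positivity
    nlinarith
  · rw [min_eq_right h.le]
    have hyR : R ≤ clip c R := by
      have h1 : clip c R < 1 := h.trans_le hx.2
      have h2 : min R 1 ≤ clip c R := le_max_right _ _
      rcases le_total R 1 with h3 | h3
      · rwa [min_eq_left h3] at h2
      · rw [min_eq_right h3] at h2
        exact absurd h2 h1.not_ge
    set y := clip c R
    have hy0 : 0 < y := hc.trans_le hy.1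
    have hLy : L - y ≤ max (L - P) (max (L - R) 0) :=
      (sub_le_sub_left hyR L).trans (le_max_of_le_right (le_max_left _ _))
    have hLy0 : 0 ≤ L - y := by linarith
    calc x ^ 2 * θ / y - θ * L ≤ L ^ 2 * θ / y - θ * L := by gcongr
      _ = θ * L * (L - y) / y := by field_simp
      _ ≤ Θ * 1 * (L - y) / c := by
          gcongr
          · exact hL.2
          · exact hy.1
      _ = Θ / c * (L - y) := by ring
      _ ≤ _ := by gcongr

/-- A component of a solution of the truncated system falls below `exp (-∫ θ)` by at most the
integral of the maximal deficit of both components. -/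
theorem deficit_le_integral {T c Θ : ℝ} {θ P R : ℝ → ℝ} {G : ℝ → ℝ → ℝ → ℝ} (hc : 0 < c)
    (hθi : IntervalIntegrable θ volume 0 T) (hθ : ∀ s ∈ Icc 0 T, 0 ≤ θ s ∧ θ s ≤ Θ)
    (hcL : c ≤ Real.exp (-(Θ * T)))
    (hG : ∀ s ∈ Icc 0 T, ∀ x ∈ Icc c 1, ∀ y ∈ Icc c 1, -(x ^ 2 * θ s / min x y) ≤ G s x y)
    (hP : ContinuousOn P (Icc 0 T)) (hR : ContinuousOn R (Icc 0 T))
    (hGi : IntervalIntegrable (fun s => G s (clip c (P s)) (clip c (R s))) volume 0 T)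
    (hPe : ∀ t ∈ Icc 0 T, P t = 1 + ∫ s in t..T, G s (clip c (P s)) (clip c (R s)))
    {t : ℝ} (ht : t ∈ Icc 0 T) :
    Real.exp (-∫ r in t..T, θ r) - P t ≤ Θ / c * ∫ s in t..T,
      max (Real.exp (-∫ r in s..T, θ r) - P s) (max (Real.exp (-∫ r in s..T, θ r) - R s) 0) := by
  have hT : 0 ≤ T := ht.1.trans ht.2
  set L : ℝ → ℝ := fun s => Real.exp (-∫ r in s..T, θ r) with hLdef
  have hLc : ContinuousOn L (Icc 0 T) := (hθi.continuousOn_integral_to_right hT).neg.rexp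
  have hΘ : 0 ≤ Θ := (hθ t ht).1.trans (hθ t ht).2
  have hLmem : ∀ s ∈ Icc 0 T, L s ∈ Icc c 1 := by
    intro s hs
    have h0 : 0 ≤ ∫ r in s..T, θ r :=
      intervalIntegral.integral_nonneg hs.2 fun x hx => (hθ x ⟨hs.1.trans hx.1, hx.2⟩).1
    have h1 : ∫ r in s..T, θ r ≤ Θ * (T - s) := by
      have := intervalIntegral.integral_mono_on hs.2 (hθi.to_right_of_mem hs)
        (intervalIntegrable_const (c := Θ)) fun x hx => (hθ x ⟨hs.1.trans hx.1, hx.2⟩).2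
      simpa [mul_comm] using this
    refine ⟨hcL.trans (Real.exp_le_exp.2 ?_), Real.exp_le_one_iff.2 (neg_nonpos.2 h0)⟩
    nlinarith [hs.1]
  have hLi : IntervalIntegrable (fun s => -(θ s * L s)) volume 0 T :=
    (hθi.mul_continuousOn (by rwa [uIcc_of_le hT])).neg
  have hm : ContinuousOn (fun s => max (L s - P s) (max (L s - R s) 0)) (Icc 0 T) :=
    (hLc.sub hP).sup ((hLc.sub hR).sup continuousOn_const)
  have := le_integral_of_le_on_pos (d := fun s => L s - P s) (hLc.sub hP) (hLi.sub hGi)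
    (b := fun s => Θ / c * max (L s - P s) (max (L s - R s) 0))
    ((hm.const_smul (Θ / c)).intervalIntegrable_of_Icc hT)
    (fun s _ => mul_nonneg (by positivity) (le_max_of_le_right (le_max_right _ _)))
    (fun s hs => by
      have h1 := exp_neg_integral_eq hθi hθ hs
      rw [intervalIntegral.integral_sub (hLi.to_right_of_mem hs) (hGi.to_right_of_mem hs)]
      simp only [hLdef] at h1 ⊢
      rw [h1, hPe s hs]
      ring)
    (fun s hs hpos => by
      have h1 := neg_theta_sub_le (R := R s) hc (hLmem s hs) (sub_pos.1 hpos) (hθ s hs).1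
        (hθ s hs).2
      have hc1 : c ≤ 1 := (hLmem s hs).1.trans (hLmem s hs).2
      have h2 := hG s hs _ (clip_mem hc1 (P s)) _ (clip_mem hc1 (R s))
      linarith) ht
  rwa [intervalIntegral.integral_const_mul] at this

/-- Comparison principle for the truncated system. -/
theorem exp_neg_integral_le_of_clip {T c Θ : ℝ} {θ P R : ℝ → ℝ} {G₁ G₂ : ℝ → ℝ → ℝ → ℝ}
    (hc : 0 < c) (hθi : IntervalIntegrable θ volume 0 T)
    (hθ : ∀ s ∈ Icc 0 T, 0 ≤ θ s ∧ θ s ≤ Θ) (hcL : c ≤ Real.exp (-(Θ * T)))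
    (hG₁ : ∀ s ∈ Icc 0 T, ∀ x ∈ Icc c 1, ∀ y ∈ Icc c 1, -(x ^ 2 * θ s / min x y) ≤ G₁ s x y)
    (hG₂ : ∀ s ∈ Icc 0 T, ∀ x ∈ Icc c 1, ∀ y ∈ Icc c 1, -(x ^ 2 * θ s / min x y) ≤ G₂ s x y)
    (hP : ContinuousOn P (Icc 0 T)) (hR : ContinuousOn R (Icc 0 T))
    (hG₁i : IntervalIntegrable (fun s => G₁ s (clip c (P s)) (clip c (R s))) volume 0 T)
    (hG₂i : IntervalIntegrable (fun s => G₂ s (clip c (R s)) (clip c (P s))) volume 0 T)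
    (hPe : ∀ t ∈ Icc 0 T, P t = 1 + ∫ s in t..T, G₁ s (clip c (P s)) (clip c (R s)))
    (hRe : ∀ t ∈ Icc 0 T, R t = 1 + ∫ s in t..T, G₂ s (clip c (R s)) (clip c (P s)))
    {t : ℝ} (ht : t ∈ Icc 0 T) :
    Real.exp (-∫ r in t..T, θ r) ≤ P t ∧ Real.exp (-∫ r in t..T, θ r) ≤ R t := by
  have hT : 0 ≤ T := ht.1.trans ht.2
  have hΘ : 0 ≤ Θ := (hθ t ht).1.trans (hθ t ht).2
  have hLc : ContinuousOn (fun s => Real.exp (-∫ r in s..T, θ r)) (Icc 0 T) :=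
    (hθi.continuousOn_integral_to_right hT).neg.rexp
  have key := nonpos_of_le_mul_integral (K := Θ / c)
    ((hLc.sub hP).sup ((hLc.sub hR).sup continuousOn_const)) (by positivity) (fun s hs => by
      have h1 := deficit_le_integral hc hθi hθ hcL hG₁ hP hR hG₁i hPe hs
      have h2 := deficit_le_integral hc hθi hθ hcL hG₂ hR hP hG₂i hRe hs
      rw [intervalIntegral.integral_congr fun x _ => max_left_comm _ _ _] at h2
      have h3 := intervalIntegral.integral_nonneg (μ := volume) hs.2 fun x _ =>
        (le_max_of_le_right (le_max_right _ _) :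
          0 ≤ max (Real.exp (-∫ r in x..T, θ r) - P x)
            (max (Real.exp (-∫ r in x..T, θ r) - R x) 0))
      exact max_le h1 (max_le h2 (mul_nonneg (by positivity) h3))) ht
  exact ⟨sub_nonpos.1 ((le_max_left _ _).trans key),
    sub_nonpos.1 ((le_max_of_le_right (le_max_left _ _)).trans key)⟩

section Elliptic

variable {m : ℕ} {A : Matrix (Fin m) (Fin m) ℝ} {δ : ℝ}

theorem sum_sum_eq_dotProduct (A : Matrix (Fin m) (Fin m) ℝ) (v : Fin m → ℝ) :
    ∑ i, ∑ k, v i * A i k * v k = v ⬝ᵥ A.mulVec v := by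
  simp [dotProduct, Matrix.mulVec, Finset.mul_sum, mul_assoc]

theorem isUnit_det_of_elliptic (hδ : 0 < δ)
    (hA : ∀ v : Fin m → ℝ, δ * ∑ i, v i ^ 2 ≤ ∑ i, ∑ k, v i * A i k * v k) : IsUnit A.det := by
  rw [← Matrix.isUnit_iff_isUnit_det, ← Matrix.mulVec_injective_iff_isUnit]
  refine (injective_iff_map_eq_zero A.mulVecLin).2 fun v hv => ?_
  have h := hA v
  rw [Matrix.mulVecLin_apply] at hv
  rw [sum_sum_eq_dotProduct, hv, dotProduct_zero] at h
  have h0 : ∑ i, v i ^ 2 = 0 :=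
    le_antisymm (nonpos_of_mul_nonpos_right h hδ) (Finset.sum_nonneg fun i _ => sq_nonneg _)
  rw [Finset.sum_eq_zero_iff_of_nonneg fun i _ => sq_nonneg _] at h0
  funext i
  simpa using h0 i (Finset.mem_univ i)

theorem complete_sq_of_elliptic (hsymm : A.IsSymm) (hδ : 0 < δ)
    (hA : ∀ v : Fin m → ℝ, δ * ∑ i, v i ^ 2 ≤ ∑ i, ∑ k, v i * A i k * v k)
    (μ v : Fin m → ℝ) (r : ℝ) :
    0 ≤ ∑ i, ∑ k, v i * A i k * v k + r * (2 * ∑ i, μ i * v i) +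
      r ^ 2 * ∑ i, μ i * A⁻¹.mulVec μ i := by
  set w := A⁻¹.mulVec μ with hw
  have hAw : A.mulVec w = μ := by
    rw [hw, Matrix.mulVec_mulVec, Matrix.mul_nonsing_inv _ (isUnit_det_of_elliptic hδ hA),
      Matrix.one_mulVec]
  have h := hA (v + r • w)
  have h0 : 0 ≤ ∑ i, ∑ k, (v + r • w) i * A i k * (v + r • w) k :=
    (mul_nonneg hδ.le (Finset.sum_nonneg fun i _ => sq_nonneg _)).trans h
  rw [sum_sum_eq_dotProduct] at h0 ⊢
  have hsw : w ⬝ᵥ A.mulVec v = μ ⬝ᵥ v := by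
    rw [Matrix.dotProduct_mulVec, ← Matrix.mulVec_transpose, hsymm.eq, hAw]
  rw [Matrix.mulVec_add, Matrix.mulVec_smul, hAw, add_dotProduct, dotProduct_add, dotProduct_add,
    smul_dotProduct, smul_dotProduct, dotProduct_smul, dotProduct_smul, hsw, dotProduct_comm v μ,
    dotProduct_comm w μ] at h0
  simp only [smul_eq_mul] at h0
  change 0 ≤ _ + r * (2 * (μ ⬝ᵥ v)) + r ^ 2 * (μ ⬝ᵥ w)
  linarith

theorem sum_mul_inv_mulVec_le_of_elliptic (hδ : 0 < δ)
    (hA : ∀ v : Fin m → ℝ, δ * ∑ i, v i ^ 2 ≤ ∑ i, ∑ k, v i * A i k * v k) (μ : Fin m → ℝ) :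
    ∑ i, μ i * A⁻¹.mulVec μ i ≤ (∑ i, μ i ^ 2) / δ := by
  set w := A⁻¹.mulVec μ with hw
  have hAw : A.mulVec w = μ := by
    rw [hw, Matrix.mulVec_mulVec, Matrix.mul_nonsing_inv _ (isUnit_det_of_elliptic hδ hA),
      Matrix.one_mulVec]
  have h := hA w
  rw [sum_sum_eq_dotProduct, hAw, dotProduct_comm] at h
  change _ ≤ ∑ i, μ i * w i at h
  have h1 : ∑ i, μ i * w i ≤ δ / 2 * ∑ i, w i ^ 2 + (∑ i, μ i ^ 2) / δ / 2 := by
    rw [Finset.mul_sum, Finset.sum_div, Finset.sum_div, ← Finset.sum_add_distrib]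
    refine Finset.sum_le_sum fun i _ => ?_
    have : 0 ≤ (δ * w i - μ i) ^ 2 / (2 * δ) := by positivity
    have e : (δ * w i - μ i) ^ 2 / (2 * δ) = δ / 2 * w i ^ 2 + μ i ^ 2 / δ / 2 - μ i * w i := by
      field_simp
      ring
    linarith
  linarith

end Elliptic

/-- The quantity `μᵀ Σ⁻¹ μ` at time `t`. -/
noncomputable def theta {E : Type} [MeasurableSpace E] {m n ℓ : ℕ}
    (μ : ℝ → Fin m → ℝ) (σ : ℝ → Matrix (Fin m) (Fin n) ℝ)
    (ν : Fin ℓ → Measure E) (β : Fin ℓ → ℝ → E → Fin m → ℝ) (t : ℝ) : ℝ :=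
  ∑ i, μ t i * Matrix.mulVec (SigmaMat σ ν β t)⁻¹ (μ t) i

/-- The integral of `((1 + v · b)⁻)²` summed over all the jump measures. -/
noncomputable def excess {E : Type} [MeasurableSpace E] {m ℓ : ℕ}
    (ν : Fin ℓ → Measure E) (b : Fin ℓ → E → Fin m → ℝ) (v : Fin m → ℝ) : ℝ :=
  ∑ j, ∫ e, (max (-(1 + ∑ i, v i * b j e i)) 0) ^ 2 ∂(ν j)

theorem max_neg_one_add_sq_le (s : ℝ) : (max (-(1 + s)) 0) ^ 2 ≤ s ^ 2 := by
  rcases le_total (-(1 + s)) 0 with h | h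
  · rw [max_eq_right h, zero_pow two_ne_zero]
    exact sq_nonneg s
  · rw [max_eq_left h]
    nlinarith

theorem max_one_add_sq (s : ℝ) :
    (max (1 + s) 0) ^ 2 = 1 + 2 * s + s ^ 2 - (max (-(1 + s)) 0) ^ 2 := by
  rcases le_total (1 + s) 0 with h | h
  · rw [max_eq_right h, max_eq_left (by linarith)]
    ring
  · rw [max_eq_left h, max_eq_right (by linarith)]
    ring

/-- The standing assumptions on the coefficients of the Riccati system, with a common bound `C`. -/
structure IsEllipticCoeff {E : Type} [MeasurableSpace E] {m n ℓ : ℕ} (T C δ : ℝ)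
    (μ : ℝ → Fin m → ℝ) (σ : ℝ → Matrix (Fin m) (Fin n) ℝ)
    (ν : Fin ℓ → Measure E) (β : Fin ℓ → ℝ → E → Fin m → ℝ) : Prop where
  finite : ∀ j, IsFiniteMeasure (ν j)
  measurable_mu : Measurable μ
  mu_le : ∀ t ∈ Icc (0 : ℝ) T, ∀ i, |μ t i| ≤ C
  measurable_sigma : ∀ i k, Measurable fun t => σ t i k
  measurable_beta : ∀ j, Measurable (Function.uncurry (β j))
  beta_le : ∀ j, ∀ t ∈ Icc (0 : ℝ) T, ∀ e i, |β j t e i| ≤ C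
  pos : 0 < δ
  elliptic : ∀ t ∈ Icc (0 : ℝ) T, ∀ v : Fin m → ℝ,
    δ * ∑ i, v i ^ 2 ≤ ∑ i, ∑ k, v i * SigmaMat σ ν β t i k * v k

section Hamiltonian

variable {E : Type} [MeasurableSpace E] {m n ℓ : ℕ} {T C δ : ℝ}
  {μ : ℝ → Fin m → ℝ} {σ : ℝ → Matrix (Fin m) (Fin n) ℝ}
  {ν : Fin ℓ → Measure E} {β : Fin ℓ → ℝ → E → Fin m → ℝ}

theorem SigmaMat_neg : SigmaMat σ ν (-β) = SigmaMat σ ν β := by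
  funext t
  simp [SigmaMat]

theorem theta_neg : theta (-μ) σ ν (-β) = theta μ σ ν β := by
  funext t
  simp [theta, SigmaMat_neg, Matrix.mulVec_neg]

theorem HstarMinus_eq_HstarPlus_neg (t x y : ℝ) :
    HstarMinus μ σ ν β t x y = HstarPlus (-μ) σ ν (-β) t y x := by
  simp only [HstarMinus, HstarPlus, Hminus, Hplus, Pi.neg_apply, mul_neg, neg_mul,
    Finset.sum_neg_distrib, sub_eq_add_neg, neg_neg]

theorem SigmaMat_isSymm (t : ℝ) : (SigmaMat σ ν β t).IsSymm := by
  ext i k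
  simp [SigmaMat, mul_comm]

namespace IsEllipticCoeff

theorem neg (h : IsEllipticCoeff T C δ μ σ ν β) : IsEllipticCoeff T C δ (-μ) σ ν (-β) where
  finite := h.finite
  measurable_mu := h.measurable_mu.neg
  mu_le t ht i := by simpa using h.mu_le t ht i
  measurable_sigma := h.measurable_sigma
  measurable_beta j := (h.measurable_beta j).neg
  beta_le j t ht e i := by simpa using h.beta_le j t ht e i
  pos := h.pos
  elliptic := by simpa only [SigmaMat_neg] using h.elliptic

theorem measurable_beta_apply (h : IsEllipticCoeff T C δ μ σ ν β) (j : Fin ℓ) (i : Fin m) :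
    Measurable (fun p : ℝ × E => β j p.1 p.2 i) :=
  (measurable_pi_apply i).comp (h.measurable_beta j)

theorem measurable_beta_section (h : IsEllipticCoeff T C δ μ σ ν β) (j : Fin ℓ) (t : ℝ)
    (i : Fin m) : Measurable (fun e => β j t e i) :=
  (h.measurable_beta_apply j i).comp measurable_prodMk_left

theorem abs_sum_mul_beta_le (h : IsEllipticCoeff T C δ μ σ ν β) (j : Fin ℓ) {t : ℝ}
    (ht : t ∈ Icc 0 T) (v : Fin m → ℝ) (e : E) :
    |∑ i, v i * β j t e i| ≤ (∑ i, |v i|) * C := by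
  rw [Finset.sum_mul]
  refine (Finset.abs_sum_le_sum_abs _ _).trans (Finset.sum_le_sum fun i _ => ?_)
  rw [abs_mul]
  exact mul_le_mul_of_nonneg_left (h.beta_le j t ht e i) (abs_nonneg _)

theorem integrable_of_abs_le (h : IsEllipticCoeff T C δ μ σ ν β) {j : Fin ℓ} {f : E → ℝ}
    (hf : Measurable f) {M : ℝ} (hM : ∀ e, |f e| ≤ M) : Integrable f (ν j) :=
  have := h.finite j
  Integrable.of_bound hf.aestronglyMeasurable M (Filter.Eventually.of_forall hM)

theorem integrable_sum_mul_beta_sq (h : IsEllipticCoeff T C δ μ σ ν β) (j : Fin ℓ) {t : ℝ}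
    (ht : t ∈ Icc 0 T) (v : Fin m → ℝ) :
    Integrable (fun e => (∑ i, v i * β j t e i) ^ 2) (ν j) :=
  h.integrable_of_abs_le ((Finset.measurable_sum _ fun i _ =>
    (h.measurable_beta_section j t i).const_mul _).pow_const 2) (M := ((∑ i, |v i|) * C) ^ 2)
    fun e => by
      rw [abs_pow]
      exact pow_le_pow_left₀ (abs_nonneg _) (h.abs_sum_mul_beta_le j ht v e) 2

theorem measurable_excess_integrand (h : IsEllipticCoeff T C δ μ σ ν β) (j : Fin ℓ) (t : ℝ)
    (v : Fin m → ℝ) : Measurable fun e => (max (-(1 + ∑ i, v i * β j t e i)) 0) ^ 2 :=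
  ((((Finset.measurable_sum _ fun i _ =>
    (h.measurable_beta_section j t i).const_mul _).const_add 1).neg).max
      measurable_const).pow_const 2

theorem integrable_excess (h : IsEllipticCoeff T C δ μ σ ν β) (j : Fin ℓ) {t : ℝ}
    (ht : t ∈ Icc 0 T) (v : Fin m → ℝ) :
    Integrable (fun e => (max (-(1 + ∑ i, v i * β j t e i)) 0) ^ 2) (ν j) :=
  (h.integrable_sum_mul_beta_sq j ht v).mono
    (h.measurable_excess_integrand j t v).aestronglyMeasurable
    (Filter.Eventually.of_forall fun e => by
      rw [Real.norm_of_nonneg (sq_nonneg _), Real.norm_of_nonneg (sq_nonneg _)]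
      exact max_neg_one_add_sq_le _)

theorem quad_SigmaMat_eq (h : IsEllipticCoeff T C δ μ σ ν β) {t : ℝ} (ht : t ∈ Icc 0 T)
    (v : Fin m → ℝ) :
    ∑ i, ∑ k, v i * SigmaMat σ ν β t i k * v k =
      ∑ k, (∑ i, σ t i k * v i) ^ 2 + ∑ j, ∫ e, (∑ i, v i * β j t e i) ^ 2 ∂(ν j) := by
  have e1 : ∑ k, (∑ i, σ t i k * v i) ^ 2 =
      ∑ i, ∑ k, v i * (∑ j', σ t i j' * σ t k j') * v k := by
    simp only [sq, Finset.mul_sum, Finset.sum_mul]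
    rw [Finset.sum_comm]
    refine Finset.sum_congr rfl fun i _ => ?_
    rw [Finset.sum_comm]
    refine Finset.sum_congr rfl fun k _ => Finset.sum_congr rfl fun j _ => ?_
    ring
  have hint : ∀ j i k, Integrable (fun e => v i * v k * (β j t e i * β j t e k)) (ν j) := by
    intro j i k
    refine (h.integrable_of_abs_le ((h.measurable_beta_section j t i).mul
      (h.measurable_beta_section j t k)) (M := C * C) fun e => ?_).const_mul _
    rw [Pi.mul_apply, abs_mul]
    exact mul_le_mul (h.beta_le j t ht e i) (h.beta_le j t ht e k) (abs_nonneg _)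
      ((abs_nonneg _).trans (h.beta_le j t ht e i))
  have e2 : ∀ j, ∫ e, (∑ i, v i * β j t e i) ^ 2 ∂(ν j) =
      ∑ i, ∑ k, v i * v k * ∫ e, β j t e i * β j t e k ∂(ν j) := by
    intro j
    simp only [← integral_const_mul]
    simp_rw [← integral_finsetSum _ fun k _ => hint j _ k]
    rw [← integral_finsetSum _ fun i _ => integrable_finsetSum _ fun k _ => hint j i k]
    refine integral_congr_ae (Filter.Eventually.of_forall fun e => ?_)
    simp only [sq, Finset.sum_mul_sum]
    refine Finset.sum_congr rfl fun i _ => Finset.sum_congr rfl fun k _ => ?_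
    ring
  simp only [e1, e2]
  rw [Finset.sum_comm (γ := Fin ℓ), ← Finset.sum_add_distrib]
  refine Finset.sum_congr rfl fun i _ => ?_
  rw [Finset.sum_comm (γ := Fin ℓ), ← Finset.sum_add_distrib]
  refine Finset.sum_congr rfl fun k _ => ?_
  simp only [SigmaMat, Matrix.of_apply, ← Finset.mul_sum]
  ring

theorem Hplus_eq (h : IsEllipticCoeff T C δ μ σ ν β) {t : ℝ} (ht : t ∈ Icc 0 T)
    (v : Fin m → ℝ) (x y : ℝ) :
    Hplus μ σ ν β t v x y =
      x * (∑ i, ∑ k, v i * SigmaMat σ ν β t i k * v k - excess ν (fun j => β j t) v +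
        2 * ∑ i, μ t i * v i) + y * excess ν (fun j => β j t) v := by
  have e : ∀ j, ∫ e, (x * ((max (1 + ∑ i, v i * β j t e i) 0) ^ 2
          - 1 - 2 * ∑ i, v i * β j t e i)
        + y * (max (-(1 + ∑ i, v i * β j t e i)) 0) ^ 2) ∂(ν j) =
      x * ∫ e, (∑ i, v i * β j t e i) ^ 2 ∂(ν j) +
        (y - x) * ∫ e, (max (-(1 + ∑ i, v i * β j t e i)) 0) ^ 2 ∂(ν j) := by
    intro j
    rw [← integral_const_mul, ← integral_const_mul,
      ← integral_add ((h.integrable_sum_mul_beta_sq j ht v).const_mul _)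
        ((h.integrable_excess j ht v).const_mul _)]
    refine integral_congr_ae (Filter.Eventually.of_forall fun e => ?_)
    simp only [max_one_add_sq]
    ring
  simp only [Hplus, e, h.quad_SigmaMat_eq ht, excess, Finset.sum_add_distrib, ← Finset.mul_sum]
  ring

theorem HstarPlus_eq (h : IsEllipticCoeff T C δ μ σ ν β) {t : ℝ} (ht : t ∈ Icc 0 T) (x y : ℝ) :
    HstarPlus μ σ ν β t x y = sInf ((fun v =>
      x * (∑ i, ∑ k, v i * SigmaMat σ ν β t i k * v k - excess ν (fun j => β j t) v +
        2 * ∑ i, μ t i * v i) + y * excess ν (fun j => β j t) v) '' {v | ∀ i, 0 ≤ v i}) := by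
  simp only [HstarPlus, h.Hplus_eq ht]

theorem isHamiltonianData (h : IsEllipticCoeff T C δ μ σ ν β) {t : ℝ} (ht : t ∈ Icc 0 T) :
    IsHamiltonianData {v : Fin m → ℝ | ∀ i, 0 ≤ v i}
      (fun v => ∑ i, ∑ k, v i * SigmaMat σ ν β t i k * v k) (excess ν (fun j => β j t))
      (fun v => 2 * ∑ i, μ t i * v i) (theta μ σ ν β t) where
  exists_zero := ⟨0, by simp, by simp, by simp [excess], by simp⟩
  nonneg v := Finset.sum_nonneg fun j _ => integral_nonneg fun e => sq_nonneg _
  le_quad v := by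
    rw [h.quad_SigmaMat_eq ht]
    refine le_add_of_nonneg_of_le (Finset.sum_nonneg fun k _ => sq_nonneg _)
      (Finset.sum_le_sum fun j _ => ?_)
    exact integral_mono (h.integrable_excess j ht v) (h.integrable_sum_mul_beta_sq j ht v)
      fun e => max_neg_one_add_sq_le _
  complete_sq v r := complete_sq_of_elliptic (SigmaMat_isSymm t) h.pos (h.elliptic t ht) _ _ _

theorem theta_le (h : IsEllipticCoeff T C δ μ σ ν β) {t : ℝ} (ht : t ∈ Icc 0 T) :
    theta μ σ ν β t ≤ m * C ^ 2 / δ := by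
  refine (sum_mul_inv_mulVec_le_of_elliptic h.pos (h.elliptic t ht) (μ t)).trans ?_
  refine div_le_div_of_nonneg_right ?_ h.pos.le
  refine (Finset.sum_le_card_nsmul _ _ (C ^ 2) fun i _ => ?_).trans_eq (by simp)
  exact sq_le_sq' (abs_le.1 (h.mu_le t ht i)).1 (abs_le.1 (h.mu_le t ht i)).2

theorem measurable_SigmaMat (h : IsEllipticCoeff T C δ μ σ ν β) (i k : Fin m) :
    Measurable fun t => SigmaMat σ ν β t i k := by
  have := h.finite
  refine (Finset.measurable_sum _ fun j _ =>
    (h.measurable_sigma i j).mul (h.measurable_sigma k j)).add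
    (Finset.measurable_sum _ fun j _ => ?_)
  exact (((h.measurable_beta_apply j i).mul
    (h.measurable_beta_apply j k)).stronglyMeasurable.integral_prod_right').measurable

theorem measurable_excess (h : IsEllipticCoeff T C δ μ σ ν β) (v : Fin m → ℝ) :
    Measurable fun t => excess ν (fun j => β j t) v := by
  have := h.finite
  refine Finset.measurable_sum _ fun j _ => ?_
  have hm : Measurable fun p : ℝ × E => (max (-(1 + ∑ i, v i * β j p.1 p.2 i)) 0) ^ 2 :=
    ((((Finset.measurable_sum _ fun i _ =>
      (h.measurable_beta_apply j i).const_mul _).const_add 1).neg).max measurable_const).pow_const 2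
  exact hm.stronglyMeasurable.integral_prod_right'.measurable

theorem measurable_theta (h : IsEllipticCoeff T C δ μ σ ν β) : Measurable (theta μ σ ν β) := by
  have hS : Measurable fun t (i k : Fin m) => SigmaMat σ ν β t i k :=
    measurable_pi_lambda _ fun i => measurable_pi_lambda _ fun k => h.measurable_SigmaMat i k
  have hdet : Measurable fun t => (SigmaMat σ ν β t).det :=
    (Continuous.measurable (by fun_prop) :
      Measurable fun A : Fin m → Fin m → ℝ => (Matrix.of A).det).comp hS
  have hadj : ∀ i k, Measurable fun t => (SigmaMat σ ν β t).adjugate i k := fun i k =>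
    (Continuous.measurable (by fun_prop) :
      Measurable fun A : Fin m → Fin m → ℝ => (Matrix.of A).adjugate i k).comp hS
  have hμ : ∀ i, Measurable fun t => μ t i := fun i => (measurable_pi_apply i).comp h.measurable_mu
  refine Finset.measurable_sum _ fun i _ => (hμ i).mul ?_
  simp only [Matrix.mulVec, dotProduct, Matrix.inv_def, Ring.inverse_eq_inv, Matrix.smul_apply,
    smul_eq_mul]
  exact Finset.measurable_sum _ fun k _ => ((hdet.inv).mul (hadj i k)).mul (hμ k)

theorem theta_mem (h : IsEllipticCoeff T C δ μ σ ν β) {t : ℝ} (ht : t ∈ Icc 0 T) :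
    0 ≤ theta μ σ ν β t ∧ theta μ σ ν β t ≤ m * C ^ 2 / δ :=
  ⟨(h.isHamiltonianData ht).theta_nonneg, h.theta_le ht⟩

theorem intervalIntegrable_theta (h : IsEllipticCoeff T C δ μ σ ν β) (hT : 0 ≤ T) :
    IntervalIntegrable (theta μ σ ν β) volume 0 T := by
  rw [intervalIntegrable_iff_integrableOn_Icc_of_le hT]
  refine Measure.integrableOn_of_bounded measure_Icc_lt_top.ne
    h.measurable_theta.aestronglyMeasurable (M := m * C ^ 2 / δ)
    ((ae_restrict_iff' measurableSet_Icc).2 (Filter.Eventually.of_forall fun t ht => ?_))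
  rw [Real.norm_of_nonneg (h.theta_mem ht).1]
  exact (h.theta_mem ht).2

theorem continuous_excess (h : IsEllipticCoeff T C δ μ σ ν β) {t : ℝ} (ht : t ∈ Icc 0 T) :
    Continuous (excess ν (fun j => β j t)) := by
  refine continuous_finsetSum _ fun j _ => continuous_iff_continuousAt.2 fun v₀ => ?_
  have := h.finite j
  have hv : ∀ᶠ v : Fin m → ℝ in nhds v₀, ∑ i, |v i| < ∑ i, |v₀ i| + 1 :=
    (by fun_prop : Continuous fun v : Fin m → ℝ => ∑ i, |v i|).continuousAt.eventually_lt_const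
      (lt_add_one _)
  refine continuousAt_of_dominated (bound := fun _ => ((∑ i, |v₀ i| + 1) * |C|) ^ 2)
    (Filter.Eventually.of_forall fun v =>
      (h.measurable_excess_integrand j t v).aestronglyMeasurable) ?_ (integrable_const _)
    (Filter.Eventually.of_forall fun e => Continuous.continuousAt (by fun_prop))
  filter_upwards [hv] with v hv
  refine Filter.Eventually.of_forall fun e => ?_
  rw [Real.norm_of_nonneg (sq_nonneg _)]
  refine (max_neg_one_add_sq_le _).trans (sq_le_sq.2 ?_)
  refine (h.abs_sum_mul_beta_le j ht v e).trans (le_trans ?_ (le_abs_self _))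
  have : 0 ≤ ∑ i, |v i| := Finset.sum_nonneg fun i _ => abs_nonneg _
  exact (mul_le_mul_of_nonneg_left (le_abs_self C) this).trans
    (mul_le_mul_of_nonneg_right hv.le (abs_nonneg C))

theorem aemeasurable_HstarPlus (h : IsEllipticCoeff T C δ μ σ ν β) {f g : ℝ → ℝ}
    (hf : AEMeasurable f (volume.restrict (Icc 0 T)))
    (hg : AEMeasurable g (volume.restrict (Icc 0 T))) :
    AEMeasurable (fun t => HstarPlus μ σ ν β t (f t) (g t)) (volume.restrict (Icc 0 T)) := by
  obtain ⟨D, hDc, hD⟩ := TopologicalSpace.exists_countable_dense {v : Fin m → ℝ | ∀ i, 0 ≤ v i}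
  have := hDc.to_subtype
  have hμ : ∀ i, Measurable fun t => μ t i := fun i => (measurable_pi_apply i).comp h.measurable_mu
  have hmeas : AEMeasurable (fun t => ⨅ s : D,
      (f t * (∑ i, ∑ k, s.1.1 i * SigmaMat σ ν β t i k * s.1.1 k -
        excess ν (fun j => β j t) s.1.1 + 2 * ∑ i, μ t i * s.1.1 i) +
        g t * excess ν (fun j => β j t) s.1.1)) (volume.restrict (Icc 0 T)) := by
    refine AEMeasurable.iInf fun s => ?_
    have h1 : Measurable fun t => ∑ i, ∑ k, s.1.1 i * SigmaMat σ ν β t i k * s.1.1 k :=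
      Finset.measurable_sum _ fun i _ => Finset.measurable_sum _ fun k _ =>
        ((h.measurable_SigmaMat i k).const_mul _).mul_const _
    have h2 : Measurable fun t => 2 * ∑ i, μ t i * s.1.1 i :=
      (Finset.measurable_sum _ fun i _ => (hμ i).mul_const _).const_mul 2
    have h3 := h.measurable_excess s.1.1
    exact (hf.mul ((h1.sub h3).add h2).aemeasurable).add (hg.mul h3.aemeasurable)
  refine hmeas.congr ((ae_restrict_iff' measurableSet_Icc).2
    (Filter.Eventually.of_forall fun t ht => ?_))
  refine Eq.trans ?_ ((h.HstarPlus_eq ht _ _).trans sInf_image').symm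
  refine hD.ciInf' (f := fun s : {v : Fin m → ℝ | ∀ i, 0 ≤ v i} =>
    f t * (∑ i, ∑ k, s.1 i * SigmaMat σ ν β t i k * s.1 k -
      excess ν (fun j => β j t) s.1 + 2 * ∑ i, μ t i * s.1 i) +
      g t * excess ν (fun j => β j t) s.1) ?_
  have h1 : Continuous fun v : Fin m → ℝ => ∑ i, ∑ k, v i * SigmaMat σ ν β t i k * v k := by
    fun_prop
  have h2 : Continuous fun v : Fin m → ℝ => 2 * ∑ i, μ t i * v i := by fun_prop
  have h3 := h.continuous_excess ht
  exact ((((h1.sub h3).add h2).const_mul (f t)).add (h3.const_mul (g t))).comp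
    continuous_subtype_val

theorem HstarPlus_mem (h : IsEllipticCoeff T C δ μ σ ν β) {c t x y : ℝ} (ht : t ∈ Icc 0 T)
    (hc : 0 < c) (hx : x ∈ Icc c 1) (hy : y ∈ Icc c 1) :
    -(x ^ 2 * theta μ σ ν β t / min x y) ≤ HstarPlus μ σ ν β t x y ∧
      HstarPlus μ σ ν β t x y ≤ 0 := by
  rw [h.HstarPlus_eq ht]
  exact ⟨(h.isHamiltonianData ht).le_sInf (hc.trans_le hx.1) (hc.trans_le hy.1),
    (h.isHamiltonianData ht).sInf_nonpos (hc.trans_le hx.1) (hc.trans_le hy.1)⟩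

theorem abs_HstarPlus_sub_le (h : IsEllipticCoeff T C δ μ σ ν β) {c t x y x' y' : ℝ}
    (ht : t ∈ Icc 0 T) (hc : 0 < c) (hx : x ∈ Icc c 1) (hy : y ∈ Icc c 1) (hx' : x' ∈ Icc c 1)
    (hy' : y' ∈ Icc c 1) :
    |HstarPlus μ σ ν β t x y - HstarPlus μ σ ν β t x' y'| ≤
      (4 * (m * C ^ 2 / δ) / c ^ 2 + 4 * (m * C ^ 2 / δ) / c) * (|x - x'| + |y - y'|) := by
  rw [h.HstarPlus_eq ht, h.HstarPlus_eq ht]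
  exact (h.isHamiltonianData ht).abs_sInf_sub_le hc (h.theta_le ht) hx hy hx' hy'

theorem intervalIntegrable_HstarPlus (h : IsEllipticCoeff T C δ μ σ ν β) (hT : 0 ≤ T) {c : ℝ}
    (hc : 0 < c) {f g : ℝ → ℝ} (hf : ContinuousOn f (Icc 0 T)) (hg : ContinuousOn g (Icc 0 T))
    (hfc : ∀ t, f t ∈ Icc c 1) (hgc : ∀ t, g t ∈ Icc c 1) :
    IntervalIntegrable (fun t => HstarPlus μ σ ν β t (f t) (g t)) volume 0 T := by
  rw [intervalIntegrable_iff_integrableOn_Icc_of_le hT]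
  refine Integrable.of_bound (h.aemeasurable_HstarPlus (hf.aemeasurable measurableSet_Icc)
    (hg.aemeasurable measurableSet_Icc)).aestronglyMeasurable (1 ^ 2 * (m * C ^ 2 / δ) / c)
    ((ae_restrict_iff' measurableSet_Icc).2 (Filter.Eventually.of_forall fun t ht => ?_))
  have h1 := h.HstarPlus_mem ht hc (hfc t) (hgc t)
  have hf0 := hc.trans_le (hfc t).1
  have hθ := h.theta_mem ht
  rw [Real.norm_of_nonpos h1.2, neg_le]
  refine le_trans (neg_le_neg ?_) h1.1
  have h2 : c ≤ min (f t) (g t) := le_min (hfc t).1 (hgc t).1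
  have h3 : 0 ≤ m * C ^ 2 / δ := hθ.1.trans hθ.2
  gcongr
  · exact hθ.1
  · exact (hfc t).2
  · exact hθ.2

theorem le_one_of_eq_one_add_integral {T : ℝ} {f k : ℝ → ℝ}
    (hf : ∀ t ∈ Icc 0 T, f t = 1 + ∫ s in t..T, k s) (hk : ∀ s ∈ Icc 0 T, k s ≤ 0) {t : ℝ}
    (ht : t ∈ Icc 0 T) : f t ≤ 1 := by
  have h : 0 ≤ ∫ s in t..T, -k s := intervalIntegral.integral_nonneg ht.2 fun s hs =>
    neg_nonneg.2 (hk s ⟨ht.1.trans hs.1, hs.2⟩)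
  rw [intervalIntegral.integral_neg] at h
  linarith [hf t ht]

/-- Bounds for the solutions of the Riccati system truncated to `[c, 1]`. -/
theorem mem_Icc_of_clip (h : IsEllipticCoeff T C δ μ σ ν β) (hT : 0 ≤ T) {c : ℝ} (hc : 0 < c)
    (hcL : c ≤ Real.exp (-(m * C ^ 2 / δ * T))) {P R : ℝ → ℝ} (hP : ContinuousOn P (Icc 0 T))
    (hR : ContinuousOn R (Icc 0 T))
    (hPe : ∀ t ∈ Icc 0 T,
      P t = 1 + ∫ s in t..T, HstarPlus μ σ ν β s (clip c (P s)) (clip c (R s)))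
    (hRe : ∀ t ∈ Icc 0 T,
      R t = 1 + ∫ s in t..T, HstarMinus μ σ ν β s (clip c (P s)) (clip c (R s)))
    {t : ℝ} (ht : t ∈ Icc 0 T) :
    P t ∈ Icc (Real.exp (-∫ s in t..T, theta μ σ ν β s)) 1 ∧
      R t ∈ Icc (Real.exp (-∫ s in t..T, theta μ σ ν β s)) 1 := by
  have hΘ : 0 ≤ m * C ^ 2 / δ := (h.theta_mem ht).1.trans (h.theta_mem ht).2
  have hc1 : c ≤ 1 := hcL.trans (Real.exp_le_one_iff.2 (neg_nonpos.2 (mul_nonneg hΘ hT)))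
  have hPc : ContinuousOn (fun s => clip c (P s)) (Icc 0 T) := by fun_prop
  have hRc : ContinuousOn (fun s => clip c (R s)) (Icc 0 T) := by fun_prop
  simp only [HstarMinus_eq_HstarPlus_neg] at hRe
  have hlow := exp_neg_integral_le_of_clip (G₁ := HstarPlus μ σ ν β)
    (G₂ := HstarPlus (-μ) σ ν (-β)) hc (h.intervalIntegrable_theta hT) (fun s hs => h.theta_mem hs)
    hcL (fun s hs x hx y hy => (h.HstarPlus_mem hs hc hx hy).1)
    (fun s hs x hx y hy => by
      simpa only [theta_neg] using (h.neg.HstarPlus_mem hs hc hx hy).1)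
    hP hR (h.intervalIntegrable_HstarPlus hT hc hPc hRc (fun _ => clip_mem hc1 _)
      fun _ => clip_mem hc1 _)
    (h.neg.intervalIntegrable_HstarPlus hT hc hRc hPc (fun _ => clip_mem hc1 _)
      fun _ => clip_mem hc1 _) hPe hRe ht
  exact ⟨⟨hlow.1, le_one_of_eq_one_add_integral hPe (fun s hs =>
      (h.HstarPlus_mem hs hc (clip_mem hc1 _) (clip_mem hc1 _)).2) ht⟩,
    ⟨hlow.2, le_one_of_eq_one_add_integral hRe (fun s hs =>
      (h.neg.HstarPlus_mem hs hc (clip_mem hc1 _) (clip_mem hc1 _)).2) ht⟩⟩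

/-- The Riccati system truncated to `[c, 1]` is globally Lipschitz, hence solvable. -/
theorem exists_clip_solution (h : IsEllipticCoeff T C δ μ σ ν β) (hT : 0 ≤ T) {c : ℝ} (hc : 0 < c)
    (hc1 : c ≤ 1) : ∃ P R : ℝ → ℝ, Continuous P ∧ Continuous R ∧
      (∀ t ∈ Icc 0 T,
        P t = 1 + ∫ s in t..T, HstarPlus μ σ ν β s (clip c (P s)) (clip c (R s))) ∧
      ∀ t ∈ Icc 0 T,
        R t = 1 + ∫ s in t..T, HstarMinus μ σ ν β s (clip c (P s)) (clip c (R s)) := by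
  have hΘ : 0 ≤ m * C ^ 2 / δ :=
    (h.theta_mem ⟨le_rfl, hT⟩).1.trans (h.theta_mem ⟨le_rfl, hT⟩).2
  set K : ℝ := 4 * (m * C ^ 2 / δ) / c ^ 2 + 4 * (m * C ^ 2 / δ) / c with hK
  have hK0 : 0 ≤ K := by positivity
  have hint₁ : ∀ f : ℝ → ℝ × ℝ, Continuous f → IntervalIntegrable
      (fun s => HstarPlus μ σ ν β s (clip c (f s).1) (clip c (f s).2)) volume 0 T := fun f hf =>
    h.intervalIntegrable_HstarPlus hT hc (by fun_prop) (by fun_prop) (fun _ => clip_mem hc1 _)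
      fun _ => clip_mem hc1 _
  have hint₂ : ∀ f : ℝ → ℝ × ℝ, Continuous f → IntervalIntegrable
      (fun s => HstarPlus (-μ) σ ν (-β) s (clip c (f s).2) (clip c (f s).1)) volume 0 T :=
    fun f hf => h.neg.intervalIntegrable_HstarPlus hT hc (by fun_prop) (by fun_prop)
      (fun _ => clip_mem hc1 _) fun _ => clip_mem hc1 _
  have hint : ∀ f : ℝ → ℝ × ℝ, Continuous f → IntervalIntegrable
      (fun s => (HstarPlus μ σ ν β s (clip c (f s).1) (clip c (f s).2),
        HstarPlus (-μ) σ ν (-β) s (clip c (f s).2) (clip c (f s).1))) volume 0 T := fun f hf =>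
    ⟨(hint₁ f hf).1.prodMk (hint₂ f hf).1, (hint₁ f hf).2.prodMk (hint₂ f hf).2⟩
  have hclip : ∀ p q : ℝ × ℝ,
      |clip c p.1 - clip c q.1| ≤ ‖p - q‖ ∧ |clip c p.2 - clip c q.2| ≤ ‖p - q‖ := fun p q =>
    ⟨(abs_clip_sub_clip_le c _ _).trans (norm_fst_le (p - q)),
      (abs_clip_sub_clip_le c _ _).trans (norm_snd_le (p - q))⟩
  obtain ⟨f, hf, hfe⟩ := exists_caratheodory_solution
    (F := fun s p => (HstarPlus μ σ ν β s (clip c p.1) (clip c p.2),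
      HstarPlus (-μ) σ ν (-β) s (clip c p.2) (clip c p.1)))
    hT (mul_nonneg zero_le_two hK0) hint
    (fun s hs p q => by
      have hpq := hclip p q
      have h1 := h.abs_HstarPlus_sub_le hs hc (clip_mem hc1 p.1) (clip_mem hc1 p.2)
        (clip_mem hc1 q.1) (clip_mem hc1 q.2)
      have h2 := h.neg.abs_HstarPlus_sub_le hs hc (clip_mem hc1 p.2) (clip_mem hc1 p.1)
        (clip_mem hc1 q.2) (clip_mem hc1 q.1)
      rw [← hK] at h1 h2
      refine max_le (h1.trans ?_) (h2.trans ?_) <;>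
      · rw [mul_comm 2 K, mul_assoc]
        exact mul_le_mul_of_nonneg_left (by linarith) hK0) ((1, 1) : ℝ × ℝ)
  refine ⟨fun t => (f t).1, fun t => (f t).2, hf.fst, hf.snd, fun t ht => ?_, fun t ht => ?_⟩
  · have e := congrArg Prod.fst (hfe t ht)
    have e' := (ContinuousLinearMap.fst ℝ ℝ ℝ).intervalIntegral_comp_comm
      ((hint f hf).to_right_of_mem ht)
    exact e.trans (congrArg (1 + ·) e'.symm)
  · have e := congrArg Prod.snd (hfe t ht)
    have e' := (ContinuousLinearMap.snd ℝ ℝ ℝ).intervalIntegral_comp_comm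
      ((hint f hf).to_right_of_mem ht)
    simp only [HstarMinus_eq_HstarPlus_neg]
    exact e.trans (congrArg (1 + ·) e'.symm)

theorem exists_isPositiveRiccatiSolution (h : IsEllipticCoeff T C δ μ σ ν β) (hT : 0 ≤ T) :
    ∃ P R : ℝ → ℝ, IsPositiveRiccatiSolution μ σ ν β T P R := by
  set Θ : ℝ := m * C ^ 2 / δ with hΘdef
  have hΘ : 0 ≤ Θ := (h.theta_mem ⟨le_rfl, hT⟩).1.trans (h.theta_mem ⟨le_rfl, hT⟩).2
  set c : ℝ := Real.exp (-(Θ * T)) with hcdef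
  have hc : 0 < c := Real.exp_pos _
  have hc1 : c ≤ 1 := Real.exp_le_one_iff.2 (neg_nonpos.2 (mul_nonneg hΘ hT))
  obtain ⟨P, R, hP, hR, hPe, hRe⟩ := h.exists_clip_solution hT hc hc1
  have hcL : ∀ t ∈ Icc 0 T, c ≤ Real.exp (-∫ s in t..T, theta μ σ ν β s) := fun t ht => by
    refine Real.exp_le_exp.2 (neg_le_neg ?_)
    refine (intervalIntegral.integral_mono_on ht.2
      ((h.intervalIntegrable_theta hT).to_right_of_mem ht) intervalIntegrable_const
      fun s hs => (h.theta_mem ⟨ht.1.trans hs.1, hs.2⟩).2).trans ?_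
    rw [intervalIntegral.integral_const, smul_eq_mul, mul_comm]
    exact mul_le_mul_of_nonneg_left (by linarith [ht.1]) hΘ
  have hmem : ∀ t ∈ Icc 0 T, P t ∈ Icc c 1 ∧ R t ∈ Icc c 1 := fun t ht => by
    have hb := h.mem_Icc_of_clip hT hc le_rfl hP.continuousOn hR.continuousOn hPe hRe ht
    exact ⟨⟨(hcL t ht).trans hb.1.1, hb.1.2⟩, ⟨(hcL t ht).trans hb.2.1, hb.2.2⟩⟩
  have hclip : ∀ t ∈ Icc 0 T, ∀ s ∈ uIcc t T, clip c (P s) = P s ∧ clip c (R s) = R s :=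
    fun t ht s hs => by
      rw [uIcc_of_le ht.2] at hs
      have hs' := hmem s ⟨ht.1.trans hs.1, hs.2⟩
      exact ⟨clip_of_mem hs'.1, clip_of_mem hs'.2⟩
  refine ⟨P, R, hP.continuousOn, hR.continuousOn,
    fun t ht => ⟨hc.trans_le (hmem t ht).1.1, hc.trans_le (hmem t ht).2.1⟩,
    fun t ht => (hPe t ht).trans ?_, fun t ht => (hRe t ht).trans ?_⟩ <;>
  · congr 1
    refine intervalIntegral.integral_congr fun s hs => ?_
    simp only [(hclip t ht s hs).1, (hclip t ht s hs).2]

theorem mem_Icc_of_isPositiveRiccatiSolution (h : IsEllipticCoeff T C δ μ σ ν β) (hT : 0 ≤ T)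
    {P R : ℝ → ℝ} (hPR : IsPositiveRiccatiSolution μ σ ν β T P R) {t : ℝ} (ht : t ∈ Icc 0 T) :
    P t ∈ Icc (Real.exp (-∫ s in t..T, theta μ σ ν β s)) 1 ∧
      R t ∈ Icc (Real.exp (-∫ s in t..T, theta μ σ ν β s)) 1 := by
  obtain ⟨hP, hR, hpos, hPe, hRe⟩ := hPR
  have hP1 : ∀ s ∈ Icc 0 T, P s ≤ 1 := fun s hs => le_one_of_eq_one_add_integral hPe
    (fun r hr => by
      rw [h.HstarPlus_eq hr]
      exact (h.isHamiltonianData hr).sInf_nonpos (hpos r hr).1 (hpos r hr).2) hs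
  have hR1 : ∀ s ∈ Icc 0 T, R s ≤ 1 := fun s hs => le_one_of_eq_one_add_integral hRe
    (fun r hr => by
      rw [HstarMinus_eq_HstarPlus_neg, h.neg.HstarPlus_eq hr]
      exact (h.neg.isHamiltonianData hr).sInf_nonpos (hpos r hr).2 (hpos r hr).1) hs
  obtain ⟨a, ha, hamin⟩ := isCompact_Icc.exists_isMinOn ⟨t, ht⟩ hP
  obtain ⟨b, hb, hbmin⟩ := isCompact_Icc.exists_isMinOn ⟨t, ht⟩ hR
  set c : ℝ := min (min (P a) (R b)) (Real.exp (-(m * C ^ 2 / δ * T))) with hcdef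
  have hc : 0 < c := lt_min (lt_min (hpos a ha).1 (hpos b hb).2) (Real.exp_pos _)
  have hclip : ∀ t ∈ Icc 0 T, ∀ s ∈ uIcc t T, clip c (P s) = P s ∧ clip c (R s) = R s :=
    fun t ht s hs => by
      rw [uIcc_of_le ht.2] at hs
      have hs' : s ∈ Icc 0 T := ⟨ht.1.trans hs.1, hs.2⟩
      exact ⟨clip_of_mem ⟨((min_le_left _ _).trans (min_le_left _ _)).trans (hamin hs'), hP1 s hs'⟩,
        clip_of_mem ⟨((min_le_left _ _).trans (min_le_right _ _)).trans (hbmin hs'), hR1 s hs'⟩⟩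
  refine h.mem_Icc_of_clip hT hc (min_le_right _ _) hP hR (fun t ht => (hPe t ht).trans ?_)
    (fun t ht => (hRe t ht).trans ?_) ht <;>
  · congr 1
    refine intervalIntegral.integral_congr fun s hs => ?_
    simp only [(hclip t ht s hs).1, (hclip t ht s hs).2]

end IsEllipticCoeff

end Hamiltonian

/-- existence of a positive solution of the Riccati system, together with the
bounds `exp(−∫_t^T μ_sᵀ Σ_s⁻¹ μ_s ds) ≤ P_{±,t} ≤ 1` for every positive solution. -/
theorem stmt0 {E : Type} [MeasurableSpace E] {m n ℓ : ℕ}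
    (hm : 0 < m) (hn : 0 < n) (hl : 0 < ℓ)
    (T : ℝ) (hT : 0 < T)
    (μ : ℝ → Fin m → ℝ) (σ : ℝ → Matrix (Fin m) (Fin n) ℝ)
    (ν : Fin ℓ → Measure E) [∀ j, IsFiniteMeasure (ν j)]
    (β : Fin ℓ → ℝ → E → Fin m → ℝ)
    (hμmeas : Measurable μ) (hμbd : ∃ C, ∀ t ∈ Icc (0:ℝ) T, ∀ i, |μ t i| ≤ C)
    (hσmeas : ∀ i k, Measurable fun t => σ t i k) (hσbd : ∃ C, ∀ t ∈ Icc (0:ℝ) T, ∀ i k, |σ t i k| ≤ C)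
    (hβmeas : ∀ j, Measurable (Function.uncurry (β j)))
    (hβbd : ∃ C, ∀ j, ∀ t ∈ Icc (0:ℝ) T, ∀ e i, |β j t e i| ≤ C)
    (hβgt : ∀ j, ∀ t ∈ Icc (0:ℝ) T, ∀ e i, -1 < β j t e i)
    (δ : ℝ) (hδ : 0 < δ)
    (hell : ∀ t ∈ Icc (0:ℝ) T, ∀ v : Fin m → ℝ,
      δ * ∑ i, v i ^ 2 ≤ ∑ i, ∑ k, v i * SigmaMat σ ν β t i k * v k) :
    (∃ Pp Pm : ℝ → ℝ, IsPositiveRiccatiSolution μ σ ν β T Pp Pm) ∧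
    (∀ Pp Pm : ℝ → ℝ, IsPositiveRiccatiSolution μ σ ν β T Pp Pm →
      ∀ t ∈ Icc (0:ℝ) T,
        (Real.exp (-(∫ s in t..T,
            ∑ i, μ s i * Matrix.mulVec (SigmaMat σ ν β s)⁻¹ (μ s) i)) ≤ Pp t ∧ Pp t ≤ 1) ∧
        (Real.exp (-(∫ s in t..T,
            ∑ i, μ s i * Matrix.mulVec (SigmaMat σ ν β s)⁻¹ (μ s) i)) ≤ Pm t ∧ Pm t ≤ 1)) := by
  obtain ⟨Cμ, hCμ⟩ := hμbd
  obtain ⟨Cβ, hCβ⟩ := hβbd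
  have h : IsEllipticCoeff T (max Cμ Cβ) δ μ σ ν β :=
    { finite := inferInstance
      measurable_mu := hμmeas
      mu_le := fun t ht i => (hCμ t ht i).trans (le_max_left _ _)
      measurable_sigma := hσmeas
      measurable_beta := hβmeas
      beta_le := fun j t ht e i => (hCβ j t ht e i).trans (le_max_right _ _)
      pos := hδ
      elliptic := hell }
  exact ⟨h.exists_isPositiveRiccatiSolution hT.le, fun Pp Pm hP t ht =>
    h.mem_Icc_of_isPositiveRiccatiSolution hT.le hP ht⟩
end

section
/- The positive solution of the Riccati system is unique: if (P₊, P₋) and (P′₊, P′₋) are both positive solutions of the Riccati system, then P_{+,t} = P′_{+,t} and P_{−,t} = P′_{−,t} for all t ∈ [0,T]. -/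
open MeasureTheory Set

/-- The part of the Hamiltonian `Hplus` that multiplies `P₊`. -/
noncomputable def coeffPlus {E : Type} [MeasurableSpace E] {m n ℓ : ℕ}
    (μ : ℝ → Fin m → ℝ) (σ : ℝ → Matrix (Fin m) (Fin n) ℝ)
    (ν : Fin ℓ → Measure E) (β : Fin ℓ → ℝ → E → Fin m → ℝ)
    (t : ℝ) (v : Fin m → ℝ) : ℝ :=
  ∑ k, (∑ i, σ t i k * v i) ^ 2 + 2 * ∑ i, μ t i * v i
    + ∑ j, ∫ e, ((max (1 + ∑ i, v i * β j t e i) 0) ^ 2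
          - 1 - 2 * ∑ i, v i * β j t e i) ∂(ν j)

/-- The part of the Hamiltonian `Hplus` that multiplies `P₋`. -/
noncomputable def coeffMinus {E : Type} [MeasurableSpace E] {m ℓ : ℕ}
    (ν : Fin ℓ → Measure E) (β : Fin ℓ → ℝ → E → Fin m → ℝ)
    (t : ℝ) (v : Fin m → ℝ) : ℝ :=
  ∑ j, ∫ e, (max (-(1 + ∑ i, v i * β j t e i)) 0) ^ 2 ∂(ν j)

theorem coeffMinus_nonneg {E : Type} [MeasurableSpace E] {m ℓ : ℕ}
    (ν : Fin ℓ → Measure E) (β : Fin ℓ → ℝ → E → Fin m → ℝ)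
    (t : ℝ) (v : Fin m → ℝ) : 0 ≤ coeffMinus ν β t v :=
  Finset.sum_nonneg fun _ _ => integral_nonneg fun _ => sq_nonneg _

/-- The standing assumptions on the coefficients, with one bound `C` for `μ` and `β`. -/
structure IsBoundedElliptic {E : Type} [MeasurableSpace E] {m n ℓ : ℕ}
    (μ : ℝ → Fin m → ℝ) (σ : ℝ → Matrix (Fin m) (Fin n) ℝ)
    (ν : Fin ℓ → Measure E) (β : Fin ℓ → ℝ → E → Fin m → ℝ)
    (T C δ : ℝ) : Prop where
  measurable_drift : Measurable μ
  measurable_vol : ∀ i k, Measurable fun t => σ t i k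
  measurable_jump : ∀ j, Measurable (Function.uncurry (β j))
  abs_drift_le : ∀ t ∈ Icc (0:ℝ) T, ∀ i, |μ t i| ≤ C
  abs_jump_le : ∀ j, ∀ t ∈ Icc (0:ℝ) T, ∀ e i, |β j t e i| ≤ C
  elliptic : ∀ t ∈ Icc (0:ℝ) T, ∀ v : Fin m → ℝ,
    δ * ∑ i, v i ^ 2 ≤ ∑ i, ∑ k, v i * SigmaMat σ ν β t i k * v k

theorem abs_sum_mul_le {m : ℕ} (v b : Fin m → ℝ) {C s : ℝ} (hC : ∀ i, |b i| ≤ C)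
    (hs : ∀ i, |v i| ≤ s) : |∑ i, v i * b i| ≤ m * C * s := by
  calc |∑ i, v i * b i| ≤ ∑ i, |v i * b i| := Finset.abs_sum_le_sum_abs _ _
    _ ≤ ∑ _i : Fin m, C * s := by
        refine Finset.sum_le_sum fun i _ => ?_
        rw [abs_mul, mul_comm]
        exact mul_le_mul (hC i) (hs i) (abs_nonneg _) ((abs_nonneg _).trans (hC i))
    _ = m * C * s := by simp [mul_assoc]

section FixedTime

variable {E : Type} [MeasurableSpace E] {m : ℕ} {ν : Measure E} [IsFiniteMeasure ν]
  {b : E → Fin m → ℝ} {C : ℝ} {φ : ℝ → ℝ}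

theorem measurable_sum_mul (hb : Measurable b) (v : Fin m → ℝ) :
    Measurable fun e => ∑ i, v i * b e i :=
  Finset.measurable_fun_sum _ fun i _ => ((measurable_pi_apply i).comp hb).const_mul _

theorem integrable_comp_sum_mul (hb : Measurable b) (hC : ∀ e i, |b e i| ≤ C)
    (hφ : Continuous φ) (v : Fin m → ℝ) : Integrable (fun e => φ (∑ i, v i * b e i)) ν := by
  obtain ⟨B, hB⟩ := (isCompact_Icc (a := -(m * C * ‖v‖)) (b := m * C * ‖v‖)).exists_bound_of_continuousOn
    hφ.continuousOn
  refine Integrable.of_bound (hφ.measurable.comp (measurable_sum_mul hb v)).aestronglyMeasurable B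
    (.of_forall fun e => hB _ ?_)
  exact abs_le.1 (abs_sum_mul_le v (b e) (hC e) (norm_le_pi_norm v))

theorem continuous_integral_comp_sum_mul (hb : Measurable b) (hC : ∀ e i, |b e i| ≤ C)
    (hφ : Continuous φ) : Continuous fun v : Fin m → ℝ => ∫ e, φ (∑ i, v i * b e i) ∂ν := by
  refine continuous_iff_continuousAt.2 fun v₀ => ?_
  set s := ‖v₀‖ + 1
  obtain ⟨B, hB⟩ := (isCompact_Icc (a := -(m * C * s)) (b := m * C * s)).exists_bound_of_continuousOn
    hφ.continuousOn
  refine continuousAt_of_dominated (bound := fun _ => B)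
    (.of_forall fun v => (hφ.measurable.comp (measurable_sum_mul hb v)).aestronglyMeasurable)
    ?_ (integrable_const _) (.of_forall fun e => ?_)
  · have : ∀ᶠ v in nhds v₀, ‖v‖ < s :=
      continuous_norm.continuousAt.eventually_lt continuousAt_const (by simp [s])
    filter_upwards [this] with v hv
    refine .of_forall fun e => hB _ ?_
    exact abs_le.1 (abs_sum_mul_le v (b e) (hC e) fun i => (norm_le_pi_norm v i).trans hv.le)
  · exact (hφ.comp (by fun_prop)).continuousAt

end FixedTime

theorem Hminus_eq_Hplus_neg {E : Type} [MeasurableSpace E] {m n ℓ : ℕ}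
    (μ : ℝ → Fin m → ℝ) (σ : ℝ → Matrix (Fin m) (Fin n) ℝ)
    (ν : Fin ℓ → Measure E) (β : Fin ℓ → ℝ → E → Fin m → ℝ)
    (t : ℝ) (v : Fin m → ℝ) (p q : ℝ) :
    Hminus μ σ ν β t v p q
      = Hplus (fun t i => -μ t i) σ ν (fun j t e i => -β j t e i) t v q p := by
  simp [Hminus, Hplus, sub_eq_add_neg]

theorem HstarMinus_eq_HstarPlus_neg_s1 {E : Type} [MeasurableSpace E] {m n ℓ : ℕ}
    (μ : ℝ → Fin m → ℝ) (σ : ℝ → Matrix (Fin m) (Fin n) ℝ)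
    (ν : Fin ℓ → Measure E) (β : Fin ℓ → ℝ → E → Fin m → ℝ) (t p q : ℝ) :
    HstarMinus μ σ ν β t p q
      = HstarPlus (fun t i => -μ t i) σ ν (fun j t e i => -β j t e i) t q p := by
  simp only [HstarMinus, HstarPlus, Hminus_eq_Hplus_neg]

namespace IsBoundedElliptic

variable {E : Type} [MeasurableSpace E] {m n ℓ : ℕ}
  {μ : ℝ → Fin m → ℝ} {σ : ℝ → Matrix (Fin m) (Fin n) ℝ}
  {ν : Fin ℓ → Measure E}
  {β : Fin ℓ → ℝ → E → Fin m → ℝ} {T C δ t : ℝ}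

theorem neg (h : IsBoundedElliptic μ σ ν β T C δ) :
    IsBoundedElliptic (fun t i => -μ t i) σ ν (fun j t e i => -β j t e i) T C δ where
  measurable_drift := h.measurable_drift.neg
  measurable_vol := h.measurable_vol
  measurable_jump j := (h.measurable_jump j).neg
  abs_drift_le := by simpa using h.abs_drift_le
  abs_jump_le := by simpa using h.abs_jump_le
  elliptic := by simpa [SigmaMat] using h.elliptic

theorem measurable_jump_time (h : IsBoundedElliptic μ σ ν β T C δ) (j : Fin ℓ) (t : ℝ) :
    Measurable (β j t) :=
  (h.measurable_jump j).comp measurable_prodMk_left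

variable [∀ j, IsFiniteMeasure (ν j)]

theorem integrable_comp (h : IsBoundedElliptic μ σ ν β T C δ) (ht : t ∈ Icc 0 T) {φ : ℝ → ℝ}
    (hφ : Continuous φ) (v : Fin m → ℝ) (j : Fin ℓ) :
    Integrable (fun e => φ (∑ i, v i * β j t e i)) (ν j) :=
  integrable_comp_sum_mul (h.measurable_jump_time j t) (h.abs_jump_le j t ht) hφ v

theorem Hplus_eq (h : IsBoundedElliptic μ σ ν β T C δ) (ht : t ∈ Icc 0 T) (v : Fin m → ℝ)
    (p q : ℝ) :
    Hplus μ σ ν β t v p q = p * coeffPlus μ σ ν β t v + q * coeffMinus ν β t v := by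
  have key (j : Fin ℓ) : ∫ e, (p * ((max (1 + ∑ i, v i * β j t e i) 0) ^ 2
          - 1 - 2 * ∑ i, v i * β j t e i)
        + q * (max (-(1 + ∑ i, v i * β j t e i)) 0) ^ 2) ∂(ν j)
      = p * ∫ e, ((max (1 + ∑ i, v i * β j t e i) 0) ^ 2
          - 1 - 2 * ∑ i, v i * β j t e i) ∂(ν j)
        + q * ∫ e, (max (-(1 + ∑ i, v i * β j t e i)) 0) ^ 2 ∂(ν j) := by
    rw [integral_add, integral_const_mul, integral_const_mul]
    · exact h.integrable_comp ht (φ := fun x => p * ((max (1 + x) 0) ^ 2 - 1 - 2 * x))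
        (by fun_prop) v j
    · exact h.integrable_comp ht (φ := fun x => q * (max (-(1 + x)) 0) ^ 2) (by fun_prop) v j
  simp only [Hplus, coeffPlus, coeffMinus, key, Finset.sum_add_distrib, ← Finset.mul_sum]
  ring

theorem continuous_Hplus (h : IsBoundedElliptic μ σ ν β T C δ) (ht : t ∈ Icc 0 T) (p q : ℝ) :
    Continuous fun v => Hplus μ σ ν β t v p q := by
  have key (j : Fin ℓ) := continuous_integral_comp_sum_mul (ν := ν j) (h.measurable_jump_time j t)
    (h.abs_jump_le j t ht) (φ := fun x => p * ((max (1 + x) 0) ^ 2 - 1 - 2 * x)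
      + q * (max (-(1 + x)) 0) ^ 2) (by fun_prop)
  unfold Hplus
  fun_prop

theorem measurable_Hplus (h : IsBoundedElliptic μ σ ν β T C δ) {P Q : ℝ → ℝ}
    (hP : Measurable P) (hQ : Measurable Q) (v : Fin m → ℝ) :
    Measurable fun t => Hplus μ σ ν β t v (P t) (Q t) := by
  have hμ (i : Fin m) : Measurable fun t => μ t i :=
    (measurable_pi_apply i).comp h.measurable_drift
  have hσ := h.measurable_vol
  have hint (j : Fin ℓ) : Measurable fun t => ∫ e, (P t * ((max (1 + ∑ i, v i * β j t e i) 0) ^ 2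
          - 1 - 2 * ∑ i, v i * β j t e i)
        + Q t * (max (-(1 + ∑ i, v i * β j t e i)) 0) ^ 2) ∂(ν j) := by
    refine (StronglyMeasurable.integral_prod_right (Measurable.stronglyMeasurable ?_)).measurable
    have hβ (i : Fin m) : Measurable fun x : ℝ × E => β j x.1 x.2 i :=
      (measurable_pi_apply i).comp (h.measurable_jump j)
    unfold Function.uncurry
    fun_prop
  unfold Hplus
  fun_prop

theorem coeffPlus_add_coeffMinus (h : IsBoundedElliptic μ σ ν β T C δ) (ht : t ∈ Icc 0 T)
    (v : Fin m → ℝ) :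
    coeffPlus μ σ ν β t v + coeffMinus ν β t v
      = ∑ i, ∑ k, v i * SigmaMat σ ν β t i k * v k + 2 * ∑ i, μ t i * v i := by
  have key (j : Fin ℓ) : ∫ e, ((max (1 + ∑ i, v i * β j t e i) 0) ^ 2
          - 1 - 2 * ∑ i, v i * β j t e i) ∂(ν j)
        + ∫ e, (max (-(1 + ∑ i, v i * β j t e i)) 0) ^ 2 ∂(ν j)
      = ∑ i, ∑ k, v i * (∫ e, β j t e i * β j t e k ∂(ν j)) * v k := by
    rw [← integral_add]
    · have hint (i k : Fin m) : Integrable (fun e => v i * (β j t e i * β j t e k) * v k) (ν j) := by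
        have hm (i : Fin m) : Measurable fun e => β j t e i :=
          (measurable_pi_apply i).comp (h.measurable_jump_time j t)
        refine ((Integrable.of_bound (C := C * C) (by fun_prop)
          (.of_forall fun e => ?_)).const_mul _).mul_const _
        rw [norm_mul]
        have := h.abs_jump_le j t ht e i
        exact mul_le_mul this (h.abs_jump_le j t ht e k) (norm_nonneg _)
          ((abs_nonneg _).trans this)
      have hsq (e : E) : (max (1 + ∑ i, v i * β j t e i) 0) ^ 2 - 1 - 2 * ∑ i, v i * β j t e i
            + (max (-(1 + ∑ i, v i * β j t e i)) 0) ^ 2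
          = ∑ i, ∑ k, v i * (β j t e i * β j t e k) * v k := by
        have : (∑ i, v i * β j t e i) ^ 2 = ∑ i, ∑ k, v i * (β j t e i * β j t e k) * v k := by
          rw [sq, Finset.sum_mul_sum]
          exact Finset.sum_congr rfl fun i _ => Finset.sum_congr rfl fun k _ => by ring
        rw [← this]
        rcases le_total 0 (1 + ∑ i, v i * β j t e i) with h0 | h0
        · rw [max_eq_left h0, max_eq_right (by linarith)]; ring
        · rw [max_eq_right h0, max_eq_left (by linarith)]; ring
      simp_rw [hsq, ← integral_const_mul, ← integral_mul_const]
      rw [integral_finsetSum _ fun i _ => integrable_finsetSum _ fun k _ => hint i k]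
      exact Finset.sum_congr rfl fun i _ => integral_finsetSum _ fun k _ => hint i k
    · exact h.integrable_comp ht (φ := fun x => (max (1 + x) 0) ^ 2 - 1 - 2 * x)
        (by fun_prop) v j
    · exact h.integrable_comp ht (φ := fun x => (max (-(1 + x)) 0) ^ 2) (by fun_prop) v j
  have hvol : ∑ k, (∑ i, σ t i k * v i) ^ 2
      = ∑ i, ∑ k, v i * (∑ j, σ t i j * σ t k j) * v k := by
    simp_rw [sq, Finset.sum_mul_sum, Finset.mul_sum, Finset.sum_mul]
    rw [Finset.sum_comm]
    refine Finset.sum_congr rfl fun i _ => ?_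
    rw [Finset.sum_comm]
    exact Finset.sum_congr rfl fun k _ => Finset.sum_congr rfl fun j _ => by ring
  have hjump : ∑ j, ∑ i, ∑ k, v i * (∫ e, β j t e i * β j t e k ∂(ν j)) * v k
      = ∑ i, ∑ k, v i * (∑ j, ∫ e, β j t e i * β j t e k ∂(ν j)) * v k := by
    simp_rw [Finset.mul_sum, Finset.sum_mul]
    rw [Finset.sum_comm]
    exact Finset.sum_congr rfl fun i _ => Finset.sum_comm
  rw [Finset.sum_congr rfl fun j _ => (key j).symm, Finset.sum_add_distrib] at hjump
  simp only [coeffPlus, coeffMinus, SigmaMat, Matrix.of_apply, mul_add, add_mul,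
    Finset.sum_add_distrib]
  rw [← hvol, ← hjump]
  ring

theorem le_coeffPlus (h : IsBoundedElliptic μ σ ν β T C δ) (ht : t ∈ Icc 0 T)
    (v : Fin m → ℝ) {s : ℝ} (hs : ∀ i, |v i| ≤ s) :
    -(2 * (m * C * s) + (∑ j, (ν j).real univ) * (1 + 2 * (m * C * s))) ≤ coeffPlus μ σ ν β t v := by
  have h1 : -(m * C * s) ≤ ∑ i, μ t i * v i := by
    have := abs_sum_mul_le v (μ t) (h.abs_drift_le t ht) hs
    simp_rw [mul_comm (v _)] at this
    exact (abs_le.1 this).1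
  have h2 : 0 ≤ ∑ k, (∑ i, σ t i k * v i) ^ 2 := Finset.sum_nonneg fun _ _ => sq_nonneg _
  have h3 : -((∑ j, (ν j).real univ) * (1 + 2 * (m * C * s))) ≤
      ∑ j, ∫ e, ((max (1 + ∑ i, v i * β j t e i) 0) ^ 2
          - 1 - 2 * ∑ i, v i * β j t e i) ∂(ν j) := by
    rw [Finset.sum_mul, ← Finset.sum_neg_distrib]
    refine Finset.sum_le_sum fun j _ => ?_
    have := integral_mono (μ := ν j) (f := fun _ => -(1 + 2 * (m * C * s))) (integrable_const _)
      (h.integrable_comp ht (φ := fun x => (max (1 + x) 0) ^ 2 - 1 - 2 * x)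
        (by fun_prop) v j) fun e => ?_
    · rw [integral_const, smul_eq_mul, mul_neg] at this
      exact this
    · have := (abs_le.1 (abs_sum_mul_le v (β j t e) (h.abs_jump_le j t ht e) hs)).2
      have := sq_nonneg (max (1 + ∑ i, v i * β j t e i) 0)
      dsimp only
      linarith
  unfold coeffPlus
  linarith

end IsBoundedElliptic

/-- The infimum over `v` of `p * A v + q * B v` is bounded and Lipschitz in `(p, q) ∈ [c, C]²`, with
constants depending only on the lower bounds for `A` and the coercivity of `A + B`. -/
theorem exists_lipschitz_sInf {c C a K : ℝ} (hc : 0 < c) (hcC : c ≤ C) (ha : 0 < a) (hK : 0 ≤ K) :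
    ∃ L M : ℝ, 0 ≤ L ∧ ∀ {V : Type} (S : Set V) (v₀ : V) (A B s : V → ℝ),
      v₀ ∈ S → A v₀ = 0 → B v₀ = 0 →
      (∀ v, 0 ≤ s v) → (∀ v, 0 ≤ B v) → (∀ v, -(K * (1 + s v)) ≤ A v) →
      (∀ v, a * s v ^ 2 - K * (1 + s v) ≤ A v + B v) →
      ∀ p ∈ Icc c C, ∀ q ∈ Icc c C,
        |sInf ((fun v => p * A v + q * B v) '' S)| ≤ M ∧
        ∀ p' ∈ Icc c C, ∀ q' ∈ Icc c C,
          sInf ((fun v => p' * A v + q' * B v) '' S) - sInf ((fun v => p * A v + q * B v) '' S)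
            ≤ L * (|p - p'| + |q - q'|) := by
  have hC : 0 < C := hc.trans_le hcC
  set k := C * K with hk
  have hk0 : 0 ≤ k := by positivity
  have hca : 0 < c * a := by positivity
  set R := (1 + 2 * k) / (c * a) + 1 with hR
  have hR0 : 0 ≤ R := by positivity
  set L := (1 + k * (1 + R)) / c + K * (1 + R) with hL
  set M := k + k ^ 2 / (c * a) with hM
  refine ⟨L, M, by positivity, fun S v₀ A B s hv₀ hA0 hB0 hs hB hA hAB p hp q hq => ?_⟩
  have base : ∀ p ∈ Icc c C, ∀ q ∈ Icc c C, ∀ v,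
      c * (A v + K * (1 + s v) + B v) - k * (1 + s v) ≤ p * A v + q * B v := by
    intro p hp q hq v
    have h1 := mul_le_mul_of_nonneg_right hp.1 (by linarith [hA v] : 0 ≤ A v + K * (1 + s v))
    have h2 := mul_le_mul_of_nonneg_right hq.1 (hB v)
    have h3 := mul_le_mul_of_nonneg_right hp.2 (mul_nonneg hK (by linarith [hs v] : 0 ≤ 1 + s v))
    rw [hk]
    linarith
  have coer : ∀ p ∈ Icc c C, ∀ q ∈ Icc c C, ∀ v,
      c * a * s v ^ 2 - k * (1 + s v) ≤ p * A v + q * B v := by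
    intro p hp q hq v
    have h1 := mul_le_mul_of_nonneg_left (hAB v) hc.le
    linarith [base p hp q hq v]
  have lower : ∀ p ∈ Icc c C, ∀ q ∈ Icc c C, ∀ v, -M ≤ p * A v + q * B v := by
    intro p hp q hq v
    refine le_trans ?_ (coer p hp q hq v)
    have : k ^ 2 / (c * a) * (c * a) = k ^ 2 := by field_simp
    have h1 : 0 ≤ (c * a) * s v ^ 2 - k * s v + k ^ 2 / (c * a) := by
      refine nonneg_of_mul_nonneg_left (b := c * a) ?_ hca
      nlinarith [sq_nonneg (c * a * s v - k / 2), sq_nonneg k]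
    linarith
  have bdd : ∀ p ∈ Icc c C, ∀ q ∈ Icc c C, BddBelow ((fun v => p * A v + q * B v) '' S) := by
    rintro p hp q hq
    exact ⟨-M, by rintro _ ⟨v, -, rfl⟩; exact lower p hp q hq v⟩
  have nonpos : ∀ p ∈ Icc c C, ∀ q ∈ Icc c C, sInf ((fun v => p * A v + q * B v) '' S) ≤ 0 := by
    intro p hp q hq
    exact csInf_le (bdd p hp q hq) ⟨v₀, hv₀, by simp [hA0, hB0]⟩
  have ne : ∀ p q, ((fun v => p * A v + q * B v) '' S).Nonempty := fun p q =>
    ⟨_, v₀, hv₀, rfl⟩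
  refine ⟨?_, fun p' hp' q' hq' => ?_⟩
  · have := le_csInf (ne p q) (a := -M) (by rintro _ ⟨v, -, rfl⟩; exact lower p hp q hq v)
    have hM0 : 0 ≤ M := by positivity
    exact abs_le.2 ⟨this, (nonpos p hp q hq).trans hM0⟩
  · refine le_of_forall_pos_le_add fun ε hε => ?_
    obtain ⟨_, ⟨v, hv, rfl⟩, hlt⟩ := exists_lt_of_csInf_lt (ne p q)
      (show sInf ((fun v => p * A v + q * B v) '' S)
        < sInf ((fun v => p * A v + q * B v) '' S) + min ε 1 by
          have : 0 < min ε 1 := by positivity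
          linarith)
    dsimp only at hlt
    have hle1 : p * A v + q * B v ≤ 1 := by
      linarith [nonpos p hp q hq, min_le_right ε 1]
    have hsR : s v ≤ R := by
      by_contra! hcon
      have h1 := coer p hp q hq v
      have h2 : 1 + 2 * k < c * a * s v := by
        have : (1 + 2 * k) / (c * a) < s v := by linarith
        rwa [div_lt_iff₀' hca] at this
      have h3 : 1 ≤ s v := by
        have : 0 ≤ (1 + 2 * k) / (c * a) := by positivity
        linarith
      nlinarith
    have hbase := base p hp q hq v
    have hks : k * (1 + s v) ≤ k * (1 + R) := by gcongr
    have hKs : K * (1 + s v) ≤ K * (1 + R) := by gcongr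
    have hKs0 : 0 ≤ K * (1 + s v) := mul_nonneg hK (by linarith [hs v])
    have hsum : A v + K * (1 + s v) + B v ≤ (1 + k * (1 + R)) / c := by
      rw [le_div_iff₀' hc]; linarith
    have hAL : |A v| ≤ L := abs_le.2 ⟨by
      have : 0 ≤ (1 + k * (1 + R)) / c := by positivity
      linarith [hA v], by linarith [hB v]⟩
    have hBL : |B v| ≤ L := abs_le.2 ⟨by linarith [hB v, hA v], by linarith [hA v]⟩
    have h1 := csInf_le (bdd p' hp' q' hq') ⟨v, hv, rfl⟩
    dsimp only at h1
    have h2 : (p' - p) * A v ≤ |p - p'| * L := by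
      rw [abs_sub_comm]
      exact (le_abs_self _).trans (by rw [abs_mul]; gcongr)
    have h3 : (q' - q) * B v ≤ |q - q'| * L := by
      rw [abs_sub_comm]
      exact (le_abs_self _).trans (by rw [abs_mul]; gcongr)
    linarith [min_le_left ε 1]

/-- Backward Gronwall inequality with zero terminal value. -/
theorem eqOn_zero_of_le_mul_integral {T K : ℝ} (hT : 0 ≤ T) (hK : 0 ≤ K) {u : ℝ → ℝ}
    (hu : ContinuousOn u (Icc 0 T)) (hu0 : ∀ t ∈ Icc 0 T, 0 ≤ u t)
    (hle : ∀ t ∈ Icc 0 T, u t ≤ K * ∫ s in t..T, u s) : ∀ t ∈ Icc 0 T, u t = 0 := by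
  set r := K + 1
  obtain ⟨t₀, ht₀, hmax⟩ := isCompact_Icc.exists_isMaxOn (nonempty_Icc.2 hT)
    (show ContinuousOn (fun t => Real.exp (r * t) * u t) (Icc 0 T) by fun_prop)
  have hr : 0 < r := by positivity
  have key : ∀ t ∈ Icc 0 T, Real.exp (r * t) * u t ≤ Real.exp (r * t₀) * u t₀ := fun t ht => hmax ht
  have hint : ∫ s in t₀..T, u s ≤ ∫ s in t₀..T, Real.exp (r * t₀) * u t₀ * Real.exp (-r * s) := by
    refine intervalIntegral.integral_mono_on ht₀.2 ?_ ?_ fun s hs => ?_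
    · exact (hu.mono (Icc_subset_Icc_left ht₀.1)).intervalIntegrable_of_Icc ht₀.2
    · exact Continuous.intervalIntegrable (by fun_prop) _ _
    · have := key s (Icc_subset_Icc_left ht₀.1 hs)
      rw [neg_mul, Real.exp_neg, ← div_eq_mul_inv, le_div_iff₀ (Real.exp_pos _)]
      linarith
  have hval : ∫ s in t₀..T, Real.exp (-r * s) ≤ Real.exp (-r * t₀) / r := by
    rw [intervalIntegral.integral_comp_mul_left _ (neg_ne_zero.2 hr.ne'), integral_exp, smul_eq_mul,
      inv_neg, neg_mul, le_div_iff₀ hr]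
    have := Real.exp_pos (-(r * T))
    simp only [neg_mul]
    field_simp
    linarith
  have hzero : u t₀ = 0 := by
    rw [intervalIntegral.integral_const_mul] at hint
    have h1 : u t₀ ≤ K * (u t₀ / r) := by
      refine (hle t₀ ht₀).trans (mul_le_mul_of_nonneg_left (hint.trans ?_) hK)
      have h2 := mul_le_mul_of_nonneg_left hval
        (mul_nonneg (Real.exp_pos (r * t₀)).le (hu0 t₀ ht₀))
      refine h2.trans_eq ?_
      rw [neg_mul, Real.exp_neg]
      field_simp
    rw [← mul_div_assoc, le_div_iff₀ hr] at h1
    have := hu0 t₀ ht₀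
    simp only [r] at h1
    linarith
  intro t ht
  have := key t ht
  rw [hzero, mul_zero] at this
  exact le_antisymm (nonpos_of_mul_nonpos_right this (Real.exp_pos _)) (hu0 t ht)

namespace IsBoundedElliptic

variable {E : Type} [MeasurableSpace E] {m n ℓ : ℕ}
  {μ : ℝ → Fin m → ℝ} {σ : ℝ → Matrix (Fin m) (Fin n) ℝ}
  {ν : Fin ℓ → Measure E} [∀ j, IsFiniteMeasure (ν j)]
  {β : Fin ℓ → ℝ → E → Fin m → ℝ} {T C δ c D : ℝ}

theorem exists_lipschitz_HstarPlus (h : IsBoundedElliptic μ σ ν β T C δ) (hC : 0 ≤ C)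
    (hδ : 0 < δ) (hc : 0 < c) (hcD : c ≤ D) :
    ∃ L M : ℝ, 0 ≤ L ∧ ∀ t ∈ Icc 0 T, ∀ p ∈ Icc c D, ∀ q ∈ Icc c D,
      |HstarPlus μ σ ν β t p q| ≤ M ∧
      ∀ p' ∈ Icc c D, ∀ q' ∈ Icc c D,
        HstarPlus μ σ ν β t p' q' - HstarPlus μ σ ν β t p q ≤ L * (|p - p'| + |q - q'|) := by
  set N := ∑ j, (ν j).real univ
  have hN : 0 ≤ N := Finset.sum_nonneg fun _ _ => measureReal_nonneg
  set K := 2 * (m * C) + N * (1 + 2 * (m * C)) with hK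
  have hmC : 0 ≤ m * C := by positivity
  obtain ⟨L, M, hL, H⟩ := exists_lipschitz_sInf hc hcD hδ (show 0 ≤ K by positivity)
  refine ⟨L, M, hL, fun t ht => ?_⟩
  simp only [HstarPlus, h.Hplus_eq ht]
  refine H _ 0 _ _ (fun v => √(∑ i, v i ^ 2)) (by simp) (by simp [coeffPlus])
    (by simp [coeffMinus]) (fun v => Real.sqrt_nonneg _) (coeffMinus_nonneg ν β t)
    (fun v => ?_) fun v => ?_
  all_goals
    have hs0 := Real.sqrt_nonneg (∑ i, v i ^ 2)
    have hsq := Real.sq_sqrt (Finset.sum_nonneg fun i (_ : i ∈ Finset.univ) => sq_nonneg (v i))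
    have hvs : ∀ i, |v i| ≤ √(∑ i, v i ^ 2) := fun i => Real.abs_le_sqrt
      (Finset.single_le_sum (f := fun i => v i ^ 2) (fun i _ => sq_nonneg _) (Finset.mem_univ i))
    generalize √(∑ i, v i ^ 2) = s at *
    have hNs : 0 ≤ N * s := by positivity
    have hNmC : 0 ≤ N * (m * C) := by positivity
  · refine le_trans ?_ (h.le_coeffPlus ht v hvs)
    rw [hK]
    linarith
  · rw [h.coeffPlus_add_coeffMinus ht, hsq]
    have h1 := abs_sum_mul_le v (μ t) (h.abs_drift_le t ht) hvs
    simp_rw [mul_comm (v _)] at h1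
    have h2 := (abs_le.1 h1).1
    have hNmCs : 0 ≤ N * (m * C) * s := by positivity
    rw [hK]
    linarith [h.elliptic t ht v]

theorem intervalIntegrable_HstarPlus (h : IsBoundedElliptic μ σ ν β T C δ) (hT : 0 ≤ T)
    (hC : 0 ≤ C) (hδ : 0 < δ) (hc : 0 < c) (hcD : c ≤ D) {P Q : ℝ → ℝ}
    (hP : ContinuousOn P (Icc 0 T)) (hQ : ContinuousOn Q (Icc 0 T))
    (hPmem : ∀ t ∈ Icc 0 T, P t ∈ Icc c D) (hQmem : ∀ t ∈ Icc 0 T, Q t ∈ Icc c D) :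
    IntervalIntegrable (fun s => HstarPlus μ σ ν β s (P s) (Q s)) volume 0 T := by
  obtain ⟨L, M, -, H⟩ := h.exists_lipschitz_HstarPlus hC hδ hc hcD
  set O : Set (Fin m → ℝ) := {v | ∀ i, 0 ≤ v i}
  have : Nonempty O := ⟨0, by simp [O]⟩
  obtain ⟨d, hd, hdd⟩ := TopologicalSpace.exists_countable_dense O
  have := hd.to_subtype
  set P' := IccExtend hT ((Icc 0 T).domRestrict P)
  set Q' := IccExtend hT ((Icc 0 T).domRestrict Q)
  have hP' : Measurable P' := (continuousOn_iff_continuous_domRestrict.1 hP).Icc_extend'.measurable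
  have hQ' : Measurable Q' := (continuousOn_iff_continuous_domRestrict.1 hQ).Icc_extend'.measurable
  have hmeas : Measurable fun s => ⨅ v : d, Hplus μ σ ν β s (v : O) (P' s) (Q' s) :=
    Measurable.iInf fun v => h.measurable_Hplus hP' hQ' _
  have heq : EqOn (fun s => ⨅ v : d, Hplus μ σ ν β s (v : O) (P' s) (Q' s))
      (fun s => HstarPlus μ σ ν β s (P s) (Q s)) (Icc 0 T) := by
    intro s hs
    have hPs : P' s = P s := IccExtend_of_mem hT _ hs
    have hQs : Q' s = Q s := IccExtend_of_mem hT _ hs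
    simp only [hPs, hQs, HstarPlus, sInf_image']
    exact hdd.ciInf' (f := fun v : O => Hplus μ σ ν β s v (P s) (Q s))
      ((h.continuous_Hplus hs _ _).comp continuous_subtype_val)
  rw [intervalIntegrable_iff_integrableOn_Icc_of_le hT]
  refine IntegrableOn.congr_fun ?_ heq measurableSet_Icc
  refine Measure.integrableOn_of_bounded (M := M) (by simp) hmeas.aestronglyMeasurable ?_
  refine (ae_restrict_iff' measurableSet_Icc).2 (.of_forall fun s hs => ?_)
  refine (congrArg norm (heq hs)).trans_le ?_
  exact (H s hs _ (hPmem s hs) _ (hQmem s hs)).1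

theorem exists_abs_integral_sub_le (h : IsBoundedElliptic μ σ ν β T C δ) (hT : 0 ≤ T)
    (hC : 0 ≤ C) (hδ : 0 < δ) (hc : 0 < c) (hcD : c ≤ D) {P Q P' Q' : ℝ → ℝ}
    (hP : ContinuousOn P (Icc 0 T)) (hQ : ContinuousOn Q (Icc 0 T))
    (hP' : ContinuousOn P' (Icc 0 T)) (hQ' : ContinuousOn Q' (Icc 0 T))
    (hPmem : ∀ t ∈ Icc 0 T, P t ∈ Icc c D) (hQmem : ∀ t ∈ Icc 0 T, Q t ∈ Icc c D)
    (hPmem' : ∀ t ∈ Icc 0 T, P' t ∈ Icc c D) (hQmem' : ∀ t ∈ Icc 0 T, Q' t ∈ Icc c D) :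
    ∃ L : ℝ, 0 ≤ L ∧ ∀ t ∈ Icc 0 T,
      |(∫ s in t..T, HstarPlus μ σ ν β s (P s) (Q s))
          - ∫ s in t..T, HstarPlus μ σ ν β s (P' s) (Q' s)|
        ≤ L * ∫ s in t..T, (|P s - P' s| + |Q s - Q' s|) := by
  obtain ⟨L, M, hL, H⟩ := h.exists_lipschitz_HstarPlus hC hδ hc hcD
  refine ⟨L, hL, fun t ht => ?_⟩
  have hsub : uIcc t T ⊆ uIcc 0 T := by
    rw [uIcc_of_le ht.2, uIcc_of_le hT]
    exact Icc_subset_Icc_left ht.1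
  have hint := (h.intervalIntegrable_HstarPlus hT hC hδ hc hcD hP hQ hPmem hQmem).mono_set hsub
  have hint' :=
    (h.intervalIntegrable_HstarPlus hT hC hδ hc hcD hP' hQ' hPmem' hQmem').mono_set hsub
  rw [← intervalIntegral.integral_sub hint hint', ← intervalIntegral.integral_const_mul]
  refine (intervalIntegral.abs_integral_le_integral_abs ht.2).trans
    (intervalIntegral.integral_mono_on ht.2 (hint.sub hint').abs ?_ fun s hs => ?_)
  · refine ContinuousOn.intervalIntegrable_of_Icc ht.2 (ContinuousOn.mono ?_
      (Icc_subset_Icc_left ht.1))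
    fun_prop
  · have hs' := Icc_subset_Icc_left ht.1 hs
    have h1 := (H s hs' _ (hPmem s hs') _ (hQmem s hs')).2 _ (hPmem' s hs') _ (hQmem' s hs')
    have h2 := (H s hs' _ (hPmem' s hs') _ (hQmem' s hs')).2 _ (hPmem s hs') _ (hQmem s hs')
    rw [abs_sub_comm (P' s), abs_sub_comm (Q' s)] at h2
    exact abs_le.2 ⟨by linarith, h2⟩

end IsBoundedElliptic

theorem exists_pos_mapsTo_Icc {T : ℝ} {f : ℝ → ℝ} (hf : ContinuousOn f (Icc 0 T))
    (hpos : ∀ t ∈ Icc 0 T, 0 < f t) : ∃ c > 0, ∃ D, ∀ t ∈ Icc 0 T, f t ∈ Icc c D := by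
  obtain ⟨c, hc, hle⟩ := isCompact_Icc.exists_forall_le' hf hpos
  obtain ⟨D, hD⟩ := (isCompact_Icc.image_of_continuousOn hf).bddAbove
  exact ⟨c, hc, D, fun t ht => ⟨hle t ht, hD ⟨t, ht, rfl⟩⟩⟩

/-- uniqueness of the positive solution of the Riccati system. -/
theorem stmt1 {E : Type} [MeasurableSpace E] {m n ℓ : ℕ}
    (hm : 0 < m) (hn : 0 < n) (hl : 0 < ℓ)
    (T : ℝ) (hT : 0 < T)
    (μ : ℝ → Fin m → ℝ) (σ : ℝ → Matrix (Fin m) (Fin n) ℝ)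
    (ν : Fin ℓ → Measure E) [∀ j, IsFiniteMeasure (ν j)]
    (β : Fin ℓ → ℝ → E → Fin m → ℝ)
    (hμmeas : Measurable μ) (hμbd : ∃ C, ∀ t ∈ Icc (0:ℝ) T, ∀ i, |μ t i| ≤ C)
    (hσmeas : ∀ i k, Measurable fun t => σ t i k)
    (hσbd : ∃ C, ∀ t ∈ Icc (0:ℝ) T, ∀ i k, |σ t i k| ≤ C)
    (hβmeas : ∀ j, Measurable (Function.uncurry (β j)))
    (hβbd : ∃ C, ∀ j, ∀ t ∈ Icc (0:ℝ) T, ∀ e i, |β j t e i| ≤ C)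
    (hβgt : ∀ j, ∀ t ∈ Icc (0:ℝ) T, ∀ e i, -1 < β j t e i)
    (δ : ℝ) (hδ : 0 < δ)
    (hell : ∀ t ∈ Icc (0:ℝ) T, ∀ v : Fin m → ℝ,
      δ * ∑ i, v i ^ 2 ≤ ∑ i, ∑ k, v i * SigmaMat σ ν β t i k * v k)
    (Pp Pm Pp' Pm' : ℝ → ℝ)
    (hsol : IsPositiveRiccatiSolution μ σ ν β T Pp Pm)
    (hsol' : IsPositiveRiccatiSolution μ σ ν β T Pp' Pm') :
    ∀ t ∈ Icc (0:ℝ) T, Pp t = Pp' t ∧ Pm t = Pm' t := by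
  obtain ⟨C₁, hC₁⟩ := hμbd
  obtain ⟨C₂, hC₂⟩ := hβbd
  have hcoef : IsBoundedElliptic μ σ ν β T (max 0 (max C₁ C₂)) δ :=
    { measurable_drift := hμmeas
      measurable_vol := hσmeas
      measurable_jump := hβmeas
      abs_drift_le := fun t ht i => (hC₁ t ht i).trans (by simp)
      abs_jump_le := fun j t ht e i => (hC₂ j t ht e i).trans (by simp)
      elliptic := hell }
  have hC : 0 ≤ max 0 (max C₁ C₂) := le_max_left _ _
  obtain ⟨hPp, hPm, hpos, hPp_eq, hPm_eq⟩ := hsol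
  obtain ⟨hPp', hPm', hpos', hPp_eq', hPm_eq'⟩ := hsol'
  obtain ⟨c, hc, D, hmem⟩ := exists_pos_mapsTo_Icc (T := T)
    (f := fun t => min (min (Pp t) (Pm t)) (min (Pp' t) (Pm' t))) (by fun_prop)
    fun t ht => lt_min (lt_min (hpos t ht).1 (hpos t ht).2) (lt_min (hpos' t ht).1 (hpos' t ht).2)
  obtain ⟨c', -, D', hmem'⟩ := exists_pos_mapsTo_Icc (T := T)
    (f := fun t => max (max (Pp t) (Pm t)) (max (Pp' t) (Pm' t))) (by fun_prop)
    fun t ht => lt_max_of_lt_left (lt_max_of_lt_left (hpos t ht).1)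
  simp only [mem_Icc (a := c), mem_Icc (a := c'), le_min_iff, max_le_iff] at hmem hmem'
  have h1 : ∀ t ∈ Icc 0 T, Pp t ∈ Icc c D' := fun t ht =>
    ⟨(hmem t ht).1.1.1, (hmem' t ht).2.1.1⟩
  have h2 : ∀ t ∈ Icc 0 T, Pm t ∈ Icc c D' := fun t ht =>
    ⟨(hmem t ht).1.1.2, (hmem' t ht).2.1.2⟩
  have h1' : ∀ t ∈ Icc 0 T, Pp' t ∈ Icc c D' := fun t ht =>
    ⟨(hmem t ht).1.2.1, (hmem' t ht).2.2.1⟩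
  have h2' : ∀ t ∈ Icc 0 T, Pm' t ∈ Icc c D' := fun t ht =>
    ⟨(hmem t ht).1.2.2, (hmem' t ht).2.2.2⟩
  have hcD : c ≤ D' := (h1 0 ⟨le_rfl, hT.le⟩).1.trans (h1 0 ⟨le_rfl, hT.le⟩).2
  obtain ⟨L, hL, HL⟩ := hcoef.exists_abs_integral_sub_le hT.le hC hδ hc hcD hPp hPm hPp' hPm'
    h1 h2 h1' h2'
  obtain ⟨L', hL', HL'⟩ := hcoef.neg.exists_abs_integral_sub_le hT.le hC hδ hc hcD hPm hPp hPm' hPp'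
    h2 h1 h2' h1'
  simp only [← HstarMinus_eq_HstarPlus_neg_s1] at HL'
  have hzero := eqOn_zero_of_le_mul_integral hT.le (add_nonneg hL hL')
    (u := fun t => |Pp t - Pp' t| + |Pm t - Pm' t|) (by fun_prop) (fun t _ => by positivity)
    fun t ht => by
      have e1 := HL t ht
      have e2 := HL' t ht
      simp_rw [add_comm |Pm _ - Pm' _|] at e2
      rw [hPp_eq t ht, hPp_eq' t ht, hPm_eq t ht, hPm_eq' t ht, add_sub_add_left_eq_sub,
        add_sub_add_left_eq_sub, add_mul]
      exact add_le_add e1 e2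
  intro t ht
  have := hzero t ht
  have a1 := abs_nonneg (Pp t - Pp' t)
  have a2 := abs_nonneg (Pm t - Pm' t)
  exact ⟨sub_eq_zero.1 (abs_eq_zero.1 (by linarith)), sub_eq_zero.1 (abs_eq_zero.1 (by linarith))⟩
end
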